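/- arXiv:2312.16961 — 3 statements merged into one kernel-verified Lean document; each statement's English description precedes it below -/
import Mathlib

section
/- Let d = m + n ≥ 2, let ω be an (m,n)-weight vector, let k ∈ {1,…,d−1}, and let Λ ⊂ ℝ^d be a unimodular lattice. Suppose that for every k-dimensional linear subspace W ⊂ ℝ^d spanned by vectors of Λ there is some I ⊂ {1,…,d} of cardinality k such that μ_I > 0 and π_I(W) = ℝ^I. Then L^ω(Λ,·) is connected at k. -/
open scoped Classical
open MeasureTheory Module Matrix

noncomputable section

/-- The set of integer vectors in `ℝ^d`. -/
def intVectors (d : ℕ) : Set (Fin d → ℝ) :=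
  Set.range fun z : Fin d → ℤ => fun i => (z i : ℝ)

/-- The lattice `g ℤ^d`. -/
def latticeOf {d : ℕ} (g : Matrix (Fin d) (Fin d) ℝ) : Set (Fin d → ℝ) :=
  g.mulVec '' intVectors d

/-- The `i`-th successive minimum of a lattice `Λ ⊆ ℝ^d` with respect to the closed unit
cube (the sup-norm unit ball): the least `r > 0` such that `r C` contains `i` linearly
independent vectors of `Λ`. -/
def succMin (d : ℕ) (Λ : Set (Fin d → ℝ)) (i : ℕ) : ℝ :=
  sInf {r : ℝ | 0 < r ∧ ∃ v : Fin i → (Fin d → ℝ),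
    (∀ j, v j ∈ Λ) ∧ LinearIndependent ℝ v ∧ ∀ j, ‖v j‖ ≤ r}

/-- `ω` is an `(m,n)`-weight vector. -/
def IsWeightVector (m n : ℕ) (ω : Fin (m + n) → ℝ) : Prop :=
  (∀ i, 0 < ω i) ∧
  (∀ i j : Fin (m + n), i ≤ j → (j : ℕ) < m → ω j ≤ ω i) ∧
  (∀ i j : Fin (m + n), m ≤ (i : ℕ) → i ≤ j → ω j ≤ ω i) ∧
  (∑ i ∈ Finset.univ.filter (fun i : Fin (m + n) => (i : ℕ) < m), ω i) = 1 ∧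
  (∑ i ∈ Finset.univ.filter (fun i : Fin (m + n) => m ≤ (i : ℕ)), ω i) = 1

/-- The signed weight: `ω i` for `i < m` (expanding directions) and `-ω i` for `i ≥ m`. -/
def signedWeight (m : ℕ) {d : ℕ} (ω : Fin d → ℝ) (i : Fin d) : ℝ :=
  if (i : ℕ) < m then ω i else -ω i

/-- The diagonal flow `a_t^ω = diag (e^{ω₁ t}, …, e^{ω_m t}, e^{-ω_{m+1} t}, …, e^{-ω_d t})`. -/
def aMat (m : ℕ) {d : ℕ} (ω : Fin d → ℝ) (t : ℝ) : Matrix (Fin d) (Fin d) ℝ :=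
  Matrix.diagonal fun i => Real.exp (signedWeight m ω i * t)

/-- `L_i^ω(Λ, t) = log λ_i (a_t^ω Λ)`. -/
def Lfun (m : ℕ) {d : ℕ} (ω : Fin d → ℝ) (Λ : Set (Fin d → ℝ)) (i : ℕ) (t : ℝ) : ℝ :=
  Real.log (succMin d ((aMat m ω t).mulVec '' Λ) i)

/-- `L^ω(Λ, ⬝)` is connected at `k`: the set `{t ≥ 0 : L_k = L_{k+1}}` is unbounded above. -/
def ConnectedAt (m : ℕ) {d : ℕ} (ω : Fin d → ℝ) (Λ : Set (Fin d → ℝ)) (k : ℕ) : Prop :=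
  ∀ T : ℝ, ∃ t : ℝ, 0 ≤ t ∧ T ≤ t ∧ Lfun m ω Λ k t = Lfun m ω Λ (k + 1) t

/-- `μ_I = ∑_{i ∈ I, i ≤ m} ω_i - ∑_{i ∈ I, i ≥ m+1} ω_i`. -/
def muI (m : ℕ) {d : ℕ} (ω : Fin d → ℝ) (I : Finset (Fin d)) : ℝ :=
  ∑ i ∈ I, signedWeight m ω i

/-- The orthogonal projection `π_I : ℝ^d → ℝ^I`. -/
def coordProj (d : ℕ) (I : Finset (Fin d)) : (Fin d → ℝ) →ₗ[ℝ] (Fin d → ℝ) where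
  toFun v := fun i => if i ∈ I then v i else 0
  map_add' u v := by funext i; by_cases h : i ∈ I <;> simp [h]
  map_smul' c v := by funext i; by_cases h : i ∈ I <;> simp [h]

/-- The coordinate subspace `ℝ^I = span {e_i : i ∈ I}`. -/
def coordSubspace (d : ℕ) (I : Finset (Fin d)) : Submodule ℝ (Fin d → ℝ) :=
  Submodule.span ℝ {v | ∃ i ∈ I, v = Pi.single i (1 : ℝ)}

/-- The coefficient of `e_I` in `w 0 ∧ ⋯ ∧ w (k-1) ∈ ⋀^k ℝ^d`, i.e. the `I`-rows minor
`det (w_{j i})_{j ∈ I, 1 ≤ i ≤ k}`. -/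
def gramCoeff {d k : ℕ} (w : Fin k → Fin d → ℝ) (I : Finset (Fin d)) : ℝ :=
  if h : I.card = k then
    Matrix.det (Matrix.of fun r c : Fin k => w c (I.orderEmbOfFin h r))
  else 0

/-- The minor `det A(I, J)` of a square matrix. -/
def subDet {d : ℕ} (A : Matrix (Fin d) (Fin d) ℝ) (k : ℕ) (I J : Finset (Fin d)) : ℝ :=
  if h : I.card = k ∧ J.card = k then
    Matrix.det (Matrix.of fun r c : Fin k => A (I.orderEmbOfFin h.1 r) (J.orderEmbOfFin h.2 c))
  else 0

/-- The largest eigenvalue of `a_1^ω` appearing in the decomposition of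
`w 0 ∧ ⋯ ∧ w (k-1)` into eigenvectors of `a_1^ω` in `⋀^k ℝ^d`. -/
def largestEigAlong (m : ℕ) {d k : ℕ} (ω : Fin d → ℝ) (w : Fin k → Fin d → ℝ) : ℝ :=
  sSup {r : ℝ | ∃ I : Finset (Fin d), I.card = k ∧ gramCoeff w I ≠ 0 ∧ r = Real.exp (muI m ω I)}

/-- `E_j = span (e_1, …, e_j)` (the first `j` coordinates, 0-indexed internally). -/
def Espan (d : ℕ) (j : ℕ) : Submodule ℝ (Fin d → ℝ) :=
  Submodule.span ℝ {v | ∃ i : Fin d, (i : ℕ) < j ∧ v = Pi.single i (1 : ℝ)}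

/-- `E'_{j+1} = span (e_{j+1}, …, e_m)` (0-indexed: coordinates `≥ j`). -/
def Eprime (m : ℕ) (j : ℕ) : Submodule ℝ (Fin m → ℝ) :=
  Submodule.span ℝ {v | ∃ i : Fin m, j ≤ (i : ℕ) ∧ v = Pi.single i (1 : ℝ)}

/-- `I(W) = {i ∈ {m+1,…,d} : dim (W ∩ E_i) > dim (W ∩ E_{i-1})}`. -/
def Iset (m : ℕ) {d : ℕ} (W : Submodule ℝ (Fin d → ℝ)) : Finset (Fin d) :=
  Finset.univ.filter fun i : Fin d =>
    m ≤ (i : ℕ) ∧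
      finrank ℝ ↥(W ⊓ Espan d (i : ℕ)) < finrank ℝ ↥(W ⊓ Espan d ((i : ℕ) + 1))

/-- `ψ(W) = ∑_{i ∈ I(W)} ω_i`. -/
def psiF (m : ℕ) {d : ℕ} (ω : Fin d → ℝ) (W : Submodule ℝ (Fin d → ℝ)) : ℝ :=
  ∑ i ∈ Iset m W, ω i

/-- `J(W') = {j ∈ {1,…,m} : dim (W' ∩ ⟨e_{j+1},…,e_m⟩) < dim (W' ∩ ⟨e_j,…,e_m⟩)}`. -/
def Jset {m : ℕ} (W' : Submodule ℝ (Fin m → ℝ)) : Finset (Fin m) :=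
  Finset.univ.filter fun j : Fin m =>
    finrank ℝ ↥(W' ⊓ Eprime m ((j : ℕ) + 1)) < finrank ℝ ↥(W' ⊓ Eprime m (j : ℕ))

/-- `φ(W') = ∑_{j ∈ J(W')} ω_j`. -/
def phiF (m n : ℕ) (ω : Fin (m + n) → ℝ) (W' : Submodule ℝ (Fin m → ℝ)) : ℝ :=
  ∑ j ∈ Jset W', ω (Fin.castAdd n j)

/-- `u(x) = [[Iₘ, x], [0, Iₙ]]`. -/
def uMat (m n : ℕ) (x : Matrix (Fin m) (Fin n) ℝ) : Matrix (Fin (m + n)) (Fin (m + n)) ℝ :=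
  Matrix.reindex finSumFinEquiv finSumFinEquiv (Matrix.fromBlocks 1 x 0 1)

/-- `x̃ ∈ M_{m,d}(ℝ)`: the first `m` rows of `u(x)`. -/
def xTil (m n : ℕ) (x : Matrix (Fin m) (Fin n) ℝ) : Matrix (Fin m) (Fin (m + n)) ℝ :=
  Matrix.of fun i j => uMat m n x (Fin.castAdd n i) j

/-- `ker x̃` as a subspace of `ℝ^d`. -/
def kerXtil (m n : ℕ) (x : Matrix (Fin m) (Fin n) ℝ) : Submodule ℝ (Fin (m + n) → ℝ) :=
  LinearMap.ker (xTil m n x).mulVecLin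

/-- The `k`-pencil `P^ω_{W,a,b} = {x : ψ(ker x̃ ∩ W) ≥ a ∧ φ(x̃ W) ≤ b}`. -/
def pencil (m n : ℕ) (ω : Fin (m + n) → ℝ) (W : Submodule ℝ (Fin (m + n) → ℝ)) (a b : ℝ) :
    Set (Matrix (Fin m) (Fin n) ℝ) :=
  {x | a ≤ psiF m ω (kerXtil m n x ⊓ W) ∧ phiF m n ω (W.map (xTil m n x).mulVecLin) ≤ b}

/-- A subspace of `ℝ^d` is rational (defined over `ℚ`) if it is spanned by rational vectors. -/
def IsRationalSubspace {d : ℕ} (W : Submodule ℝ (Fin d → ℝ)) : Prop :=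
  ∃ S : Set (Fin d → ℚ),
    Submodule.span ℝ ((fun q : Fin d → ℚ => fun i => ((q i : ℝ))) '' S) = W

/-- A subset of `M_{m,n}(ℝ)` is Zariski closed if it is the common zero locus of a set of
real polynomials in the matrix entries. -/
def IsZariskiClosed {m n : ℕ} (S : Set (Matrix (Fin m) (Fin n) ℝ)) : Prop :=
  ∃ P : Set (MvPolynomial (Fin m × Fin n) ℝ),
    S = {x | ∀ p ∈ P, MvPolynomial.eval (fun ij => x ij.1 ij.2) p = 0}

/-- View a point of Euclidean space indexed by matrix entries as a matrix. -/
def matOfEuc (m n : ℕ) (z : EuclideanSpace ℝ (Fin m × Fin n)) : Matrix (Fin m) (Fin n) ℝ :=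
  Matrix.of fun i j => z (i, j)

/-- `M` is a `p`-dimensional analytic submanifold: around every point, `M` agrees with the
image of an injective analytic immersion of an open subset of `ℝ^p`. -/
def IsAnalyticSubmanifold {ι : Type*} [Fintype ι] (p : ℕ) (M : Set (EuclideanSpace ℝ ι)) :
    Prop :=
  ∀ z ∈ M, ∃ (U : Set (EuclideanSpace ℝ (Fin p)))
      (f : EuclideanSpace ℝ (Fin p) → EuclideanSpace ℝ ι) (V : Set (EuclideanSpace ℝ ι)),
    IsOpen U ∧ IsOpen V ∧ z ∈ V ∧ AnalyticOnNhd ℝ f U ∧ Set.InjOn f U ∧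
      (∀ u ∈ U, Function.Injective (fderiv ℝ f u)) ∧ f '' U = M ∩ V

/-- A column matrix from a vector. -/
def colMat (m : ℕ) (ξ : Fin m → ℝ) : Matrix (Fin m) (Fin 1) ℝ :=
  Matrix.of fun i _ => ξ i

/-- A row matrix from a vector. -/
def rowMat (n : ℕ) (ξ : Fin n → ℝ) : Matrix (Fin 1) (Fin n) ℝ :=
  Matrix.of fun _ j => ξ j

/-- The minor of `x` with rows `P` and columns `Q`. -/
def minorDet (m n : ℕ) (x : Matrix (Fin m) (Fin n) ℝ) (P : Finset (Fin m))
    (Q : Finset (Fin n)) (h : P.card = Q.card) : ℝ :=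
  Matrix.det (Matrix.of fun r c : Fin P.card =>
    x (P.orderEmbOfFin rfl r) (Q.orderEmbOfFin h.symm c))

/-- `𝓓(𝓡)`: the set of all `p × p` minors of `x` with increasing rows in `{1,…,m}` and
increasing columns in `𝓡`, for `1 ≤ p ≤ min m (d - k)`. -/
def Dset (m n k : ℕ) (x : Matrix (Fin m) (Fin n) ℝ) (R : Finset (Fin n)) : Set ℝ :=
  {r | ∃ (P : Finset (Fin m)) (Q : Finset (Fin n)) (h : P.card = Q.card),
    Q ⊆ R ∧ 1 ≤ P.card ∧ P.card ≤ min m (m + n - k) ∧ r = minorDet m n x P Q h}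


/-- Minkowski's theorem on linear forms. -/
theorem exists_int_abs_mulVec_lt {d : ℕ} (M : Matrix (Fin d) (Fin d) ℝ) (hM : M.det ≠ 0)
    (c : Fin d → ℝ) (hc : ∀ i, 0 < c i) (h : |M.det| < ∏ i, c i) :
    ∃ z : Fin d → ℤ, z ≠ 0 ∧ ∀ i, |(M *ᵥ fun j => (z j : ℝ)) i| < c i := by
  let b : Basis (Fin d) ℝ (Fin d → ℝ) := (Pi.basisFun ℝ (Fin d)).map
    (Matrix.toLinearEquiv' M (Matrix.invertibleOfIsUnitDet M (isUnit_iff_ne_zero.2 hM)))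
  have hb : ∀ j i, b j i = M i j := fun j i => by
    simp [b, Matrix.toLinearEquiv']
  have hbM : Matrix.of b = Mᵀ := by ext j i; simp [hb]
  have hvol := ZSpan.volume_fundamentalDomain b
  rw [hbM, Matrix.det_transpose] at hvol
  have hfund := ZSpan.isAddFundamentalDomain' b volume
  have hcount : Countable ↥(Submodule.span ℤ (Set.range b)).toAddSubgroup :=
    inferInstanceAs (Countable ↥(Submodule.span ℤ (Set.range b)))
  obtain ⟨⟨x, hx⟩, hx0, hxs⟩ := exists_ne_zero_mem_lattice_of_measure_mul_two_pow_lt_measure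
    (s := Set.univ.pi fun i => Set.Ioo (-c i) (c i)) hfund
    (by
      intro x hx i hi
      have := hx i hi
      simp only [Set.mem_Ioo, Pi.neg_apply] at this ⊢
      constructor <;> linarith)
    (convex_pi fun i _ => convex_Ioo _ _)
    (by
      rw [hvol, Real.volume_pi_Ioo, ← ENNReal.ofReal_prod_of_nonneg (fun i _ => by linarith [hc i])]
      have h2 : ∏ i, (c i - -c i) = (∏ i, c i) * 2 ^ d := by
        simp_rw [sub_neg_eq_add, ← mul_two, Finset.prod_mul_distrib]
        simp
      have h3 : (2 : ENNReal) ^ finrank ℝ (Fin d → ℝ) = ENNReal.ofReal (2 ^ d) := by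
        simp
      rw [h2, h3, ← ENNReal.ofReal_mul (abs_nonneg _)]
      have : (0 : ℝ) < 2 ^ d := by positivity
      exact (ENNReal.ofReal_lt_ofReal_iff (mul_pos (Finset.prod_pos fun i _ => hc i) this)).2
        (mul_lt_mul_of_pos_right h this))
  obtain ⟨z, hz⟩ := (Submodule.mem_span_range_iff_exists_fun ℤ).1 hx
  have hzx : (M *ᵥ fun j => (z j : ℝ)) = x := by
    rw [← hz]
    ext i
    simp [Matrix.mulVec, dotProduct, hb, mul_comm]
  refine ⟨z, ?_, fun i => ?_⟩
  · rintro rfl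
    apply hx0
    ext i
    simp [← hz]
  · rw [hzx, abs_lt]
    exact hxs i (Set.mem_univ _)

/-- The `QR` decomposition of the matrix with columns `v i`. -/
theorem exists_orthogonal_mulVec_triangular {d : ℕ} (v : Fin d → Fin d → ℝ) :
    ∃ Q : Matrix (Fin d) (Fin d) ℝ, Qᵀ * Q = 1 ∧ ∀ i j, i < j → (Q *ᵥ v i) j = 0 := by
  let u := InnerProductSpace.gramSchmidtOrthonormalBasis (𝕜 := ℝ)
    (E := EuclideanSpace ℝ (Fin d)) (ι := Fin d) (by simp) (fun i => WithLp.toLp 2 (v i))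
  refine ⟨Matrix.of fun i j => u i j, ?_, fun i j hij => ?_⟩
  · rw [mul_eq_one_comm]
    ext i j
    have := orthonormal_iff_ite.1 u.orthonormal i j
    rw [Matrix.one_apply, ← this]
    simp [Matrix.mul_apply, PiLp.inner_apply, mul_comm]
  · have := InnerProductSpace.gramSchmidtOrthonormalBasis_inv_triangular (𝕜 := ℝ)
      (E := EuclideanSpace ℝ (Fin d)) (ι := Fin d) (by simp) (fun i => WithLp.toLp 2 (v i)) hij
    simpa [PiLp.inner_apply, Matrix.mulVec, dotProduct, mul_comm] using this

theorem mulVec_int_mem_latticeOf {d : ℕ} (A : Matrix (Fin d) (Fin d) ℝ) (z : Fin d → ℤ) :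
    (A *ᵥ fun i => (z i : ℝ)) ∈ latticeOf A :=
  ⟨_, ⟨z, rfl⟩, rfl⟩

theorem mem_latticeOf {d : ℕ} {A : Matrix (Fin d) (Fin d) ℝ} {x : Fin d → ℝ} :
    x ∈ latticeOf A ↔ ∃ z : Fin d → ℤ, (A *ᵥ fun i => (z i : ℝ)) = x := by
  simp [latticeOf, intVectors]

theorem mulVec_image_latticeOf {d : ℕ} (B A : Matrix (Fin d) (Fin d) ℝ) :
    B.mulVec '' latticeOf A = latticeOf (B * A) := by
  simp only [latticeOf, Set.image_image, Matrix.mulVec_mulVec]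

theorem abs_le_one_of_transpose_mul_self {d : ℕ} {Q : Matrix (Fin d) (Fin d) ℝ} (hQ : Qᵀ * Q = 1)
    (i j : Fin d) : |Q i j| ≤ 1 := by
  have h := congrFun (congrFun hQ j) j
  rw [Matrix.mul_apply, Matrix.one_apply_eq] at h
  have h1 := Finset.single_le_sum (f := fun i => Qᵀ j i * Q i j)
    (fun i _ => mul_self_nonneg (Q i j)) (Finset.mem_univ i)
  rw [h] at h1
  rw [← abs_one, ← sq_le_sq, one_pow, sq]
  exact h1

/-- A weak form of the upper bound in Minkowski's second theorem, for vectors that realise the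
successive minima of a unimodular lattice. -/
theorem prod_norm_le_of_minimal {d : ℕ} (A : Matrix (Fin d) (Fin d) ℝ) (hA : |A.det| = 1)
    (v : Fin d → Fin d → ℝ) (hv : ∀ i, v i ∈ latticeOf A) (hli : LinearIndependent ℝ v)
    (hmin : ∀ i, ∀ x ∈ latticeOf A, x ∉ Submodule.span ℝ (v '' Set.Iio i) → ‖v i‖ ≤ ‖x‖) :
    ∏ i, ‖v i‖ ≤ (d : ℝ) ^ d := by
  by_contra! hcon
  obtain ⟨Q, hQ, htri⟩ := exists_orthogonal_mulVec_triangular v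
  have hpos : ∀ i, 0 < ‖v i‖ := fun i => norm_pos_iff.2 (hli.ne_zero i)
  have hmono : ∀ i j, i ≤ j → ‖v i‖ ≤ ‖v j‖ := fun i j hij =>
    hmin i _ (hv j) (hli.notMem_span_image (by simpa using hij))
  have hQdet : |Q.det| = 1 := by
    have := congrArg Matrix.det hQ
    rw [Matrix.det_mul, Matrix.det_transpose, Matrix.det_one, ← sq] at this
    rwa [← abs_one, ← sq_eq_sq_iff_abs_eq_abs, one_pow]
  have hdet : |(Q * A).det| = 1 := by rw [Matrix.det_mul, abs_mul, hQdet, hA, one_mul]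
  have hd : ∀ _ : Fin d, (0 : ℝ) < d := fun i => by exact_mod_cast i.pos
  obtain ⟨z, hz0, hz⟩ := exists_int_abs_mulVec_lt (Q * A)
    (by intro h; simp [h] at hdet) (fun i => ‖v i‖ / d) (fun i => div_pos (hpos i) (hd i))
    (by
      rw [hdet, Finset.prod_div_distrib, Finset.prod_const, Finset.card_univ, Fintype.card_fin,
        one_lt_div]
      · exact hcon
      · rcases Nat.eq_zero_or_pos d with rfl | h
        · simp
        · positivity)
  set x := A *ᵥ fun j => (z j : ℝ) with hx
  have hxlat : x ∈ latticeOf A := mulVec_int_mem_latticeOf A z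
  have hQx : ∀ i, |(Q *ᵥ x) i| < ‖v i‖ / d := by
    intro i
    have := hz i
    rwa [← Matrix.mulVec_mulVec] at this
  have hx0 : x ≠ 0 := by
    intro h
    have := Matrix.eq_zero_of_mulVec_eq_zero (by intro h; simp [h] at hA) h
    exact hz0 (funext fun i => by simpa using congrFun this i)
  let S : ℕ → Submodule ℝ (Fin d → ℝ) := fun n => Submodule.span ℝ (v '' {i | (i : ℕ) < n})
  have hSd : x ∈ S d := by
    have : {i : Fin d | (i : ℕ) < d} = Set.univ := by ext; simp
    simp only [S, this, Set.image_univ]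
    rw [hli.span_eq_top_of_card_eq_finrank' (by simp)]
    trivial
  have hex : ∃ n, x ∈ S n := ⟨d, hSd⟩
  obtain ⟨n, hn⟩ : ∃ n, Nat.find hex = n + 1 := by
    refine Nat.exists_eq_succ_of_ne_zero fun h => hx0 ?_
    have := Nat.find_spec hex
    simpa [h, S] using this
  have hnd : n < d := by
    have := Nat.find_min' hex hSd
    omega
  have hxn : x ∉ S n := Nat.find_min hex (by omega)
  have hxn1 : x ∈ S (n + 1) := hn ▸ Nat.find_spec hex
  let j : Fin d := ⟨n, hnd⟩
  have hjx : ‖v j‖ ≤ ‖x‖ := hmin j x hxlat hxn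
  have hzero : ∀ i, j < i → (Q *ᵥ x) i = 0 := by
    intro i hji
    have hle : S (n + 1) ≤ LinearMap.ker (LinearMap.proj (R := ℝ) (φ := fun _ => ℝ) i ∘ₗ Q.mulVecLin) := by
      rw [Submodule.span_le]
      rintro _ ⟨l, hl, rfl⟩
      have : l < i := lt_of_le_of_lt (Nat.le_of_lt_succ (show (l : ℕ) < n + 1 from hl)) hji
      simpa using htri l i this
    simpa using hle hxn1
  have hbound : ∀ i, |(Q *ᵥ x) i| < ‖v j‖ / d := by
    intro i
    rcases lt_or_ge j i with h | h
    · rw [hzero i h, abs_zero]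
      exact div_pos (hpos j) (hd j)
    · exact (hQx i).trans_le (by gcongr; exact hmono i j h)
  have hxx : x = Qᵀ *ᵥ (Q *ᵥ x) := by rw [Matrix.mulVec_mulVec, hQ, Matrix.one_mulVec]
  have : ‖x‖ < ‖v j‖ := by
    rw [pi_norm_lt_iff (hpos j)]
    intro l
    rw [hxx, Matrix.mulVec, dotProduct, Real.norm_eq_abs]
    have : Nonempty (Fin d) := ⟨j⟩
    calc |∑ i, Qᵀ l i * (Q *ᵥ x) i| ≤ ∑ i, |Qᵀ l i * (Q *ᵥ x) i| := Finset.abs_sum_le_sum_abs _ _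
      _ < ∑ _i : Fin d, ‖v j‖ / d := by
          refine Finset.sum_lt_sum_of_nonempty Finset.univ_nonempty fun i _ => ?_
          rw [abs_mul]
          exact (mul_le_of_le_one_left (abs_nonneg _)
            (abs_le_one_of_transpose_mul_self hQ i l)).trans_lt (hbound i)
      _ = ‖v j‖ := by
          have := (hd j).ne'
          simp
          field_simp
  exact absurd hjx this.not_ge

theorem finite_latticeOf_norm_le {d : ℕ} {A : Matrix (Fin d) (Fin d) ℝ} (hA : A.det ≠ 0) (R : ℝ) :
    {x | x ∈ latticeOf A ∧ ‖x‖ ≤ R}.Finite := by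
  have hinv : A⁻¹ * A = 1 := Matrix.nonsing_inv_mul A (isUnit_iff_ne_zero.2 hA)
  let f : (Fin d → ℝ) →L[ℝ] (Fin d → ℝ) := LinearMap.toContinuousLinearMap A⁻¹.mulVecLin
  have hfin : (Metric.closedBall (0 : Fin d → ℤ) (‖f‖ * R)).Finite :=
    (isCompact_closedBall _ _).finite_of_discrete
  refine (hfin.image fun z => A *ᵥ fun i => (z i : ℝ)).subset ?_
  rintro _ ⟨hx, hxR⟩
  obtain ⟨z, rfl⟩ := mem_latticeOf.1 hx
  refine ⟨z, ?_, rfl⟩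
  have h1 : f (A *ᵥ fun i => (z i : ℝ)) = fun i => (z i : ℝ) := by
    simp [f, Matrix.mulVec_mulVec, hinv]
  have h2 := f.le_of_opNorm_le_of_le le_rfl hxR
  rw [h1] at h2
  have h0 : 0 ≤ ‖f‖ * R := (norm_nonneg _).trans h2
  rw [mem_closedBall_zero_iff, pi_norm_le_iff_of_nonneg h0]
  intro i
  rw [Int.norm_eq_abs]
  exact (norm_le_pi_norm (fun i => (z i : ℝ)) i).trans h2

theorem exists_mem_latticeOf_notMem {d : ℕ} {A : Matrix (Fin d) (Fin d) ℝ} (hA : A.det ≠ 0)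
    {V : Submodule ℝ (Fin d → ℝ)} (hV : V ≠ ⊤) : ∃ x ∈ latticeOf A, x ∉ V := by
  by_contra! h
  refine hV (Submodule.eq_top_iff'.2 fun x => ?_)
  have hx : A *ᵥ (A⁻¹ *ᵥ x) = x := by
    rw [Matrix.mulVec_mulVec, Matrix.mul_nonsing_inv A (isUnit_iff_ne_zero.2 hA),
      Matrix.one_mulVec]
  rw [← hx, Matrix.mulVec_eq_sum]
  refine Submodule.sum_mem _ fun i _ => ?_
  rw [op_smul_eq_smul]
  refine Submodule.smul_mem _ _ (h _ ?_)
  convert mulVec_int_mem_latticeOf A (Pi.single i 1) using 1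
  have : (fun j => ((Pi.single i 1 : Fin d → ℤ) j : ℝ)) = Pi.single i 1 := by
    ext j
    by_cases hj : j = i
    · subst hj; simp
    · simp [hj]
  rw [this, Matrix.mulVec_single_one]
  rfl

theorem exists_shortest_notMem {d : ℕ} {A : Matrix (Fin d) (Fin d) ℝ} (hA : A.det ≠ 0)
    {V : Submodule ℝ (Fin d → ℝ)} (hV : V ≠ ⊤) :
    ∃ x ∈ latticeOf A, x ∉ V ∧ ∀ y ∈ latticeOf A, y ∉ V → ‖x‖ ≤ ‖y‖ := by
  obtain ⟨x₀, hx₀, hx₀V⟩ := exists_mem_latticeOf_notMem hA hV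
  obtain ⟨x, ⟨⟨hx, hxR⟩, hxV⟩, hmin⟩ := Set.exists_min_image
    ({x | x ∈ latticeOf A ∧ ‖x‖ ≤ ‖x₀‖} \ V) (fun x => ‖x‖)
    ((finite_latticeOf_norm_le hA _).subset Set.sdiff_subset) ⟨x₀, ⟨hx₀, le_rfl⟩, hx₀V⟩
  refine ⟨x, hx, hxV, fun y hy hyV => ?_⟩
  rcases le_total ‖y‖ ‖x₀‖ with h | h
  · exact hmin y ⟨⟨hy, h⟩, hyV⟩
  · exact hxR.trans h

theorem finrank_span_image_Iio_le {d : ℕ} (v : Fin d → Fin d → ℝ) (i : Fin d) :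
    finrank ℝ (Submodule.span ℝ (v '' Set.Iio i)) ≤ i := by
  have := finrank_span_finset_le_card (R := ℝ) ((Finset.Iio i).image v)
  rw [Finset.coe_image, Finset.coe_Iio] at this
  exact this.trans (Finset.card_image_le.trans (by simp))

theorem linearIndependent_of_notMem_span_Iio {d : ℕ} {v : Fin d → Fin d → ℝ}
    (h : ∀ i, v i ∉ Submodule.span ℝ (v '' Set.Iio i)) : LinearIndependent ℝ v := by
  have key : ∀ n ≤ d, LinearIndepOn ℝ v {i : Fin d | (i : ℕ) < n} := by
    intro n
    induction n with
    | zero => intro _; simp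
    | succ n ih =>
      intro hn
      have : {i : Fin d | (i : ℕ) < n + 1} = insert ⟨n, hn⟩ {i : Fin d | (i : ℕ) < n} := by
        ext i
        simp only [Set.mem_ofPred_eq, Set.mem_insert_iff, Fin.ext_iff]
        omega
      rw [this]
      exact (ih (by omega)).insert (h ⟨n, hn⟩)
  have := key d le_rfl
  rwa [show {i : Fin d | (i : ℕ) < d} = Set.univ by ext; simp, linearIndepOn_univ_iff] at this

/-- Successively shortest linearly independent vectors of a lattice. -/
theorem exists_minimal_family {d : ℕ} {A : Matrix (Fin d) (Fin d) ℝ} (hA : A.det ≠ 0) :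
    ∃ v : Fin d → Fin d → ℝ, (∀ i, v i ∈ latticeOf A) ∧ LinearIndependent ℝ v ∧
      ∀ i, ∀ x ∈ latticeOf A, x ∉ Submodule.span ℝ (v '' Set.Iio i) → ‖v i‖ ≤ ‖x‖ := by
  choose! f hf hfV hmin using fun (V : Submodule ℝ (Fin d → ℝ)) (hV : V ≠ ⊤) =>
    exists_shortest_notMem hA hV
  let F : ∀ i : Fin d, (∀ j, j < i → Fin d → ℝ) → Fin d → ℝ := fun i r =>
    f (Submodule.span ℝ (Set.range fun j : Set.Iio i => r j j.2))
  let v : Fin d → Fin d → ℝ := wellFounded_lt.fix F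
  have hv : ∀ i, v i = f (Submodule.span ℝ (v '' Set.Iio i)) := by
    intro i
    rw [Set.image_eq_range]
    exact wellFounded_lt.fix_eq F i
  have htop : ∀ i, Submodule.span ℝ (v '' Set.Iio i) ≠ ⊤ := by
    intro i h
    have := finrank_span_image_Iio_le v i
    rw [h, finrank_top, finrank_fin_fun] at this
    omega
  refine ⟨v, fun i => hv i ▸ hf _ (htop i), linearIndependent_of_notMem_span_Iio fun i => ?_,
    fun i => ?_⟩
  · conv in v i => rw [hv i]
    exact hfV _ (htop i)
  · rw [hv i]
    exact hmin _ (htop i)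

theorem prod_castLE_le {d k : ℕ} (hk : k ≤ d) {a : Fin d → ℝ} (ha : ∀ i, 0 ≤ a i)
    (hmono : Monotone a) {C : ℝ} (hC : 1 ≤ C) (h : ∏ i, a i ≤ C) :
    ∏ i : Fin k, a (Fin.castLE hk i) ≤ C := by
  by_cases h1 : ∀ i : Fin d, k ≤ (i : ℕ) → 1 ≤ a i
  · refine le_trans ?_ h
    have himg : ∏ i : Fin k, a (Fin.castLE hk i) =
        ∏ i ∈ Finset.univ.filter (fun i : Fin d => (i : ℕ) < k), a i := by
      refine Finset.prod_bij (fun i _ => Fin.castLE hk i) (by simp) (by simp)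
        (fun i hi => ⟨⟨i, (Finset.mem_filter.1 hi).2⟩, by simp, rfl⟩) (fun _ _ => rfl)
    rw [himg, ← Finset.prod_filter_mul_prod_filter_not Finset.univ (fun i : Fin d => (i : ℕ) < k)]
    refine le_mul_of_one_le_right (Finset.prod_nonneg fun i _ => ha i) ?_
    refine Finset.one_le_prod fun i hi => h1 i ?_
    simpa using hi
  · push Not at h1
    obtain ⟨i, hi, hi1⟩ := h1
    refine (Finset.prod_le_one (fun j _ => ha _) fun j _ => ?_).trans hC
    refine (hmono ?_).trans hi1.le
    rw [Fin.le_def, Fin.val_castLE]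
    omega

theorem abs_det_le_factorial_mul_prod_norm {d k : ℕ} (u : Fin k → Fin d → ℝ) (e : Fin k → Fin d) :
    |(Matrix.of fun r c => u c (e r)).det| ≤ (k.factorial : ℝ) * ∏ c, ‖u c‖ := by
  rw [Matrix.det_apply']
  refine (Finset.abs_sum_le_sum_abs _ _).trans ?_
  refine (Finset.sum_le_card_nsmul _ _ (∏ c, ‖u c‖) fun σ _ => ?_).trans_eq ?_
  · have hσ : |(((Equiv.Perm.sign σ : ℤˣ) : ℤ) : ℝ)| = 1 := by
      rcases Int.units_eq_one_or (Equiv.Perm.sign σ) with h | h <;> simp [h]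
    rw [abs_mul, hσ, one_mul, Finset.abs_prod]
    exact Finset.prod_le_prod (fun _ _ => abs_nonneg _) fun c _ => norm_le_pi_norm (u c) _
  · rw [Finset.card_univ, Fintype.card_perm, Fintype.card_fin, nsmul_eq_mul]

/-- The Plücker coordinates of `k` independent lattice vectors in a fixed rational `k`-dimensional
subspace are bounded below by a constant multiple of those of a fixed family spanning it. -/
theorem exists_pos_mul_abs_det_le {d k : ℕ} {g : Matrix (Fin d) (Fin d) ℝ} (hg : g.det ≠ 0)
    {w : Fin k → Fin d → ℝ} (hw : ∀ j, w j ∈ latticeOf g) (hwli : LinearIndependent ℝ w) :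
    ∃ δ : ℝ, 0 < δ ∧ ∀ x : Fin k → Fin d → ℝ, (∀ j, x j ∈ latticeOf g) →
      LinearIndependent ℝ x → (∀ j, x j ∈ Submodule.span ℝ (Set.range w)) →
      ∀ e : Fin k → Fin d, δ * |(Matrix.of fun r c => w c (e r)).det| ≤
        |(Matrix.of fun r c => x c (e r)).det| := by
  choose y hy using fun j => mem_latticeOf.1 (hw j)
  let Y : Matrix (Fin d) (Fin k) ℤ := Matrix.of fun i c => y c i
  let YR : Matrix (Fin d) (Fin k) ℝ := Y.map (Int.castRingHom ℝ)
  have hgY : g * YR = Matrix.of fun i c => w c i := by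
    ext i c
    simp [YR, Y, Matrix.mul_apply, ← hy, Matrix.mulVec, dotProduct]
  have hcomb : ∀ (v : Fin k → Fin d → ℝ) (a : Fin k → ℝ),
      (Matrix.of fun i c => v c i) *ᵥ a = ∑ c, a c • v c := by
    intro v a
    ext i
    simp [Matrix.mulVec, dotProduct, mul_comm]
  have hker : ∀ v : Fin k → Fin d → ℝ, LinearIndependent ℝ v → ∀ a : Fin k → ℝ,
      (Matrix.of fun i c => v c i) *ᵥ a = 0 → a = 0 := by
    intro v hv a ha
    rw [hcomb] at ha
    exact funext (Fintype.linearIndependent_iff.1 hv a ha)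
  have hGram : (YRᵀ * YR).det ≠ 0 := by
    intro h
    obtain ⟨a, ha0, ha⟩ := Matrix.exists_mulVec_eq_zero_iff.2 h
    have h1 := (Matrix.conjTranspose_mul_self_mulVec_eq_zero YR a).1
      (by rwa [Matrix.conjTranspose_eq_transpose_of_trivial])
    refine ha0 (hker w hwli a ?_)
    rw [← hgY, ← Matrix.mulVec_mulVec, h1, Matrix.mulVec_zero]
  refine ⟨|(YRᵀ * YR).det|⁻¹, inv_pos.2 (abs_pos.2 hGram), fun x hx hxli hxw e => ?_⟩
  choose z hz using fun j => mem_latticeOf.1 (hx j)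
  choose b hb using fun j => (Submodule.mem_span_range_iff_exists_fun ℝ).1 (hxw j)
  let Z : Matrix (Fin d) (Fin k) ℤ := Matrix.of fun i c => z c i
  let ZR : Matrix (Fin d) (Fin k) ℝ := Z.map (Int.castRingHom ℝ)
  have hgZ : g * ZR = Matrix.of fun i c => x c i := by
    ext i c
    simp [ZR, Z, Matrix.mul_apply, ← hz, Matrix.mulVec, dotProduct]
  let B : Matrix (Fin k) (Fin k) ℝ := Matrix.of fun a c => b c a
  have hwB : (Matrix.of fun i c => w c i) * B = Matrix.of fun i c => x c i := by
    ext i c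
    simp [B, Matrix.mul_apply, ← hb, mul_comm]
  have hZ : YR * B = ZR := by
    have h1 : g * (YR * B) = g * ZR := by rw [← Matrix.mul_assoc, hgY, hwB, hgZ]
    have h2 := congrArg (g⁻¹ * ·) h1
    simpa only [Matrix.nonsing_inv_mul_cancel_left _ _ (isUnit_iff_ne_zero.2 hg)] using h2
  have hB : B.det ≠ 0 := by
    intro h
    obtain ⟨a, ha0, ha⟩ := Matrix.exists_mulVec_eq_zero_iff.2 h
    refine ha0 (hker x hxli a ?_)
    rw [← hwB, ← Matrix.mulVec_mulVec, ha, Matrix.mulVec_zero]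
  have hint : (YRᵀ * YR).det * B.det = (((Yᵀ * Z).det : ℤ) : ℝ) := by
    rw [← Matrix.det_mul, Matrix.mul_assoc, hZ, ← eq_intCast (Int.castRingHom ℝ), RingHom.map_det,
      RingHom.mapMatrix_apply, Matrix.map_mul, Matrix.transpose_map]
  have hone : 1 ≤ |(YRᵀ * YR).det| * |B.det| := by
    rw [← abs_mul, hint]
    have : (Yᵀ * Z).det ≠ 0 := by
      intro h
      rw [h, Int.cast_zero] at hint
      exact mul_ne_zero hGram hB hint
    exact_mod_cast Int.one_le_abs this
  have hxe : (Matrix.of fun r c => x c (e r)) = (Matrix.of fun r c => w c (e r)) * B := by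
    ext r c
    exact (congrFun (congrFun hwB (e r)) c).symm
  rw [hxe, Matrix.det_mul, abs_mul, mul_comm]
  refine mul_le_mul_of_nonneg_left ?_ (abs_nonneg _)
  rwa [inv_le_iff_one_le_mul₀' (abs_pos.2 hGram)]

theorem det_ne_zero_of_map_coordProj_eq {d k : ℕ} {w : Fin k → Fin d → ℝ} {I : Finset (Fin d)}
    (hI : I.card = k)
    (h : (Submodule.span ℝ (Set.range w)).map (coordProj d I) = coordSubspace d I) :
    (Matrix.of fun r c => w c (I.orderEmbOfFin hI r)).det ≠ 0 := by
  have hex : ∀ r : Fin k, ∃ a : Fin k → ℝ, ∀ s,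
      (∑ c, w c (I.orderEmbOfFin hI s) * a c) = if s = r then 1 else 0 := by
    intro r
    have hmem : Pi.single (I.orderEmbOfFin hI r) (1 : ℝ) ∈ coordSubspace d I :=
      Submodule.subset_span ⟨_, I.orderEmbOfFin_mem hI r, rfl⟩
    rw [← h] at hmem
    obtain ⟨x, hx, hxr⟩ := hmem
    obtain ⟨a, rfl⟩ := (Submodule.mem_span_range_iff_exists_fun ℝ).1 hx
    refine ⟨a, fun s => ?_⟩
    have h1 := congrFun hxr (I.orderEmbOfFin hI s)
    simpa [coordProj, I.orderEmbOfFin_mem hI s, Pi.single_apply, mul_comm] using h1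
  choose a ha using hex
  refine Matrix.det_ne_zero_of_right_inverse (B := Matrix.of fun c r => a r c) ?_
  ext s r
  simp [Matrix.mul_apply, ha, Matrix.one_apply]

theorem succMin_le {d i : ℕ} {Λ : Set (Fin d → ℝ)} {r : ℝ} (hr : 0 < r) {v : Fin i → Fin d → ℝ}
    (hv : ∀ j, v j ∈ Λ) (hli : LinearIndependent ℝ v) (hvr : ∀ j, ‖v j‖ ≤ r) :
    succMin d Λ i ≤ r :=
  csInf_le ⟨0, fun _ h => h.1.le⟩ ⟨hr, v, hv, hli, hvr⟩

theorem succMin_set_nonempty {d i : ℕ} (hi : i ≤ d) {A : Matrix (Fin d) (Fin d) ℝ}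
    (hA : A.det ≠ 0) : {r : ℝ | 0 < r ∧ ∃ v : Fin i → (Fin d → ℝ),
      (∀ j, v j ∈ latticeOf A) ∧ LinearIndependent ℝ v ∧ ∀ j, ‖v j‖ ≤ r}.Nonempty := by
  obtain ⟨v, hv, hli, -⟩ := exists_minimal_family hA
  refine ⟨‖v‖ + 1, by positivity, v ∘ Fin.castLE hi, fun j => hv _,
    hli.comp _ (Fin.castLE_injective hi), fun j => ?_⟩
  exact (norm_le_pi_norm v _).trans (by simp)

theorem exists_of_succMin_lt {d i : ℕ} (hi : i ≤ d) {A : Matrix (Fin d) (Fin d) ℝ}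
    (hA : A.det ≠ 0) {c : ℝ} (hc : succMin d (latticeOf A) i < c) :
    ∃ v : Fin i → Fin d → ℝ, (∀ j, v j ∈ latticeOf A) ∧ LinearIndependent ℝ v ∧
      ∀ j, ‖v j‖ < c := by
  obtain ⟨r, ⟨-, v, hv, hli, hvr⟩, hrc⟩ := exists_lt_of_csInf_lt (succMin_set_nonempty hi hA) hc
  exact ⟨v, hv, hli, fun j => (hvr j).trans_lt hrc⟩

theorem succMin_le_succ {d i : ℕ} (hi : i + 1 ≤ d) {A : Matrix (Fin d) (Fin d) ℝ}
    (hA : A.det ≠ 0) : succMin d (latticeOf A) i ≤ succMin d (latticeOf A) (i + 1) := by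
  refine csInf_le_csInf ⟨0, fun _ h => h.1.le⟩ (succMin_set_nonempty hi hA) ?_
  rintro r ⟨hr, v, hv, hli, hvr⟩
  exact ⟨hr, v ∘ Fin.castSucc, fun j => hv _, hli.comp _ (Fin.castSucc_injective i),
    fun j => hvr _⟩

/-- The span of the vectors of `Λ` that `B` maps to vectors shorter than `c`. -/
def shortSpan {d : ℕ} (Λ : Set (Fin d → ℝ)) (B : Matrix (Fin d) (Fin d) ℝ) (c : ℝ) :
    Submodule ℝ (Fin d → ℝ) :=
  Submodule.span ℝ {x | x ∈ Λ ∧ ‖B *ᵥ x‖ < c}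

theorem finrank_shortSpan_le {d k : ℕ} {g B : Matrix (Fin d) (Fin d) ℝ} (hB : B.det ≠ 0) :
    finrank ℝ (shortSpan (latticeOf g) B (succMin d (latticeOf (B * g)) (k + 1))) ≤ k := by
  by_contra! hcon
  obtain ⟨f, hf, -, hli⟩ := Submodule.exists_fun_fin_finrank_span_eq ℝ
    {x | x ∈ latticeOf g ∧ ‖B *ᵥ x‖ < succMin d (latticeOf (B * g)) (k + 1)}
  have hk : k + 1 ≤ finrank ℝ (Submodule.span ℝ
    {x | x ∈ latticeOf g ∧ ‖B *ᵥ x‖ < succMin d (latticeOf (B * g)) (k + 1)}) := hcon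
  let u : Fin (k + 1) → Fin d → ℝ := fun j => B *ᵥ f (Fin.castLE hk j)
  have hu : LinearIndependent ℝ u :=
    (hli.comp _ (Fin.castLE_injective hk)).map' B.mulVecLin (LinearMap.ker_eq_bot'.2 fun x hx =>
      Matrix.eq_zero_of_mulVec_eq_zero hB hx)
  obtain ⟨j, -, hj⟩ := Finset.exists_max_image Finset.univ (fun j => ‖u j‖) Finset.univ_nonempty
  refine (hf (Fin.castLE hk j)).2.not_ge (succMin_le (norm_pos_iff.2 (hu.ne_zero j)) (v := u)
    (fun j => ?_) hu fun i => hj i (Finset.mem_univ i))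
  rw [← mulVec_image_latticeOf]
  exact ⟨_, (hf _).1, rfl⟩

theorem norm_aMat_mulVec_le (m : ℕ) {d : ℕ} (ω : Fin d → ℝ) (s t : ℝ) (x : Fin d → ℝ) :
    ‖aMat m ω s *ᵥ x‖ ≤ Real.exp ((∑ i, |signedWeight m ω i|) * |s - t|) * ‖aMat m ω t *ᵥ x‖ := by
  rw [pi_norm_le_iff_of_nonneg (by positivity)]
  intro i
  have h1 : (aMat m ω s *ᵥ x) i = Real.exp (signedWeight m ω i * (s - t)) * (aMat m ω t *ᵥ x) i := by
    simp only [aMat, Matrix.mulVec_diagonal]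
    rw [← mul_assoc, ← Real.exp_add]
    ring_nf
  rw [h1, norm_mul, Real.norm_eq_abs, Real.abs_exp]
  refine mul_le_mul (Real.exp_le_exp.2 ((le_abs_self _).trans ?_)) (norm_le_pi_norm _ i)
    (norm_nonneg _) (Real.exp_nonneg _)
  rw [abs_mul]
  gcongr
  exact Finset.single_le_sum (f := fun i => |signedWeight m ω i|) (fun _ _ => abs_nonneg _)
    (Finset.mem_univ i)

theorem det_aMat_ne_zero (m : ℕ) {d : ℕ} (ω : Fin d → ℝ) (t : ℝ) : (aMat m ω t).det ≠ 0 := by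
  rw [aMat, Matrix.det_diagonal]
  exact Finset.prod_ne_zero_iff.2 fun i _ => Real.exp_ne_zero _

theorem IsWeightVector.det_aMat {m n : ℕ} {ω : Fin (m + n) → ℝ} (hω : IsWeightVector m n ω)
    (t : ℝ) : (aMat m ω t).det = 1 := by
  obtain ⟨-, -, -, h1, h2⟩ := hω
  have h0 : ∑ i, signedWeight m ω i = 0 := by
    simp only [signedWeight, Finset.sum_ite, not_lt, Finset.sum_neg_distrib, h1, h2]
    ring
  rw [aMat, Matrix.det_diagonal, ← Real.exp_sum, ← Finset.sum_mul, h0, zero_mul, Real.exp_zero]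

theorem succMin_aMat_le (m : ℕ) {d i : ℕ} (hi : i ≤ d) (ω : Fin d → ℝ)
    {g : Matrix (Fin d) (Fin d) ℝ} (hg : g.det ≠ 0) (s t : ℝ) :
    succMin d (latticeOf (aMat m ω s * g)) i ≤
      Real.exp ((∑ i, |signedWeight m ω i|) * |s - t|) * succMin d (latticeOf (aMat m ω t * g)) i := by
  have hdet : (aMat m ω t * g).det ≠ 0 := by
    rw [Matrix.det_mul]
    exact mul_ne_zero (det_aMat_ne_zero m ω t) hg
  set E := Real.exp ((∑ i, |signedWeight m ω i|) * |s - t|) with hE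
  have hE0 : 0 < E := Real.exp_pos _
  rw [← div_le_iff₀' hE0]
  refine le_csInf (succMin_set_nonempty hi hdet) ?_
  rintro r ⟨hr, v, hv, hli, hvr⟩
  rw [div_le_iff₀' hE0]
  simp_rw [← mulVec_image_latticeOf] at hv
  choose x hx hxv using hv
  have hxli : LinearIndependent ℝ x := by
    refine LinearIndependent.of_comp (aMat m ω t).mulVecLin ?_
    convert hli using 1
    exact funext hxv
  refine succMin_le (mul_pos hE0 hr) (v := fun j => aMat m ω s *ᵥ x j) (fun j => ?_) ?_ fun j => ?_
  · rw [← mulVec_image_latticeOf]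
    exact ⟨_, hx j, rfl⟩
  · exact hxli.map' (aMat m ω s).mulVecLin (LinearMap.ker_eq_bot'.2 fun x hx =>
      Matrix.eq_zero_of_mulVec_eq_zero (det_aMat_ne_zero m ω s) hx)
  · refine (norm_aMat_mulVec_le m ω s t (x j)).trans ?_
    rw [← hE]
    gcongr
    rw [hxv]
    exact hvr j

/-- Where `λ_k < λ_{k+1}`, the span of the lattice vectors shorter than `λ_{k+1}` is `k`-dimensional
and locally constant in time. -/
theorem exists_eventually_shortSpan_eq (m : ℕ) {d k : ℕ} (hk : k + 1 ≤ d) (ω : Fin d → ℝ)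
    {g : Matrix (Fin d) (Fin d) ℝ} (hg : g.det ≠ 0) {t : ℝ}
    (hlt : succMin d (latticeOf (aMat m ω t * g)) k <
      succMin d (latticeOf (aMat m ω t * g)) (k + 1)) :
    ∃ w : Fin k → Fin d → ℝ, (∀ j, w j ∈ latticeOf g) ∧ LinearIndependent ℝ w ∧
      ∀ᶠ s in nhds t, shortSpan (latticeOf g) (aMat m ω s)
        (succMin d (latticeOf (aMat m ω s * g)) (k + 1)) = Submodule.span ℝ (Set.range w) := by
  have hdet : (aMat m ω t * g).det ≠ 0 := by
    rw [Matrix.det_mul]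
    exact mul_ne_zero (det_aMat_ne_zero m ω t) hg
  obtain ⟨c, hc1, hc2⟩ := exists_between hlt
  obtain ⟨v, hv, hli, hvc⟩ := exists_of_succMin_lt (by omega) hdet hc1
  simp_rw [← mulVec_image_latticeOf] at hv
  choose w hw hwv using hv
  have hwli : LinearIndependent ℝ w := by
    refine LinearIndependent.of_comp (aMat m ω t).mulVecLin ?_
    convert hli using 1
    exact funext hwv
  refine ⟨w, hw, hwli, ?_⟩
  let E : ℝ → ℝ := fun s => Real.exp ((∑ i, |signedWeight m ω i|) * |s - t|)
  have hcont : Continuous fun s => E s * (E s * c) := by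
    simp only [E]
    fun_prop
  have hev : ∀ᶠ s in nhds t, E s * (E s * c) < succMin d (latticeOf (aMat m ω t * g)) (k + 1) :=
    hcont.continuousAt.eventually_lt_const (by simpa [E] using hc2)
  filter_upwards [hev] with s hs
  have hE : 0 < E s := Real.exp_pos _
  have hle := succMin_aMat_le m hk ω hg t s
  rw [abs_sub_comm] at hle
  have hsc : E s * c < succMin d (latticeOf (aMat m ω s * g)) (k + 1) :=
    lt_of_mul_lt_mul_left (hs.trans_le hle) hE.le
  symm
  refine Submodule.eq_of_le_of_finrank_le (Submodule.span_le.2 ?_) ?_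
  · rintro _ ⟨j, rfl⟩
    refine Submodule.subset_span ⟨hw j, lt_of_le_of_lt ?_ hsc⟩
    refine (norm_aMat_mulVec_le m ω s t (w j)).trans ?_
    refine mul_le_mul_of_nonneg_left ?_ hE.le
    have := hwv j
    rw [this]
    exact (hvc j).le
  · rw [finrank_span_eq_card hwli, Fintype.card_fin]
    exact finrank_shortSpan_le (det_aMat_ne_zero m ω s)

theorem mem_map_shortSpan_of_minimal {d : ℕ} {g B : Matrix (Fin d) (Fin d) ℝ} (hB : B.det ≠ 0)
    {c : ℝ} {v : Fin d → Fin d → ℝ}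
    (hmin : ∀ i, ∀ x ∈ latticeOf (B * g), x ∉ Submodule.span ℝ (v '' Set.Iio i) → ‖v i‖ ≤ ‖x‖)
    {i : Fin d} (hi : (i : ℕ) < finrank ℝ (shortSpan (latticeOf g) B c))
    {x : Fin d → ℝ} (hx : x ∈ latticeOf g) (hxv : B *ᵥ x = v i) :
    x ∈ shortSpan (latticeOf g) B c := by
  refine Submodule.subset_span ⟨hx, ?_⟩
  by_contra! hcx
  have hinj : Function.Injective B.mulVecLin := LinearMap.ker_eq_bot.1
    (LinearMap.ker_eq_bot'.2 fun x hx => Matrix.eq_zero_of_mulVec_eq_zero hB hx)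
  have hle : (shortSpan (latticeOf g) B c).map B.mulVecLin ≤
      Submodule.span ℝ (v '' Set.Iio i) := by
    rw [Submodule.map_le_iff_le_comap, shortSpan, Submodule.span_le]
    rintro y ⟨hy, hyc⟩
    by_contra hyv
    have := hmin i (B *ᵥ y) (by rw [← mulVec_image_latticeOf]; exact ⟨y, hy, rfl⟩) hyv
    rw [hxv] at hcx
    linarith
  have h1 := Submodule.finrank_mono hle
  rw [← (Submodule.equivMapOfInjective _ hinj _).finrank_eq] at h1
  have h2 := finrank_span_image_Iio_le v i
  omega

theorem det_aMat_mulVec_orderEmbOfFin (m : ℕ) {d k : ℕ} (ω : Fin d → ℝ) (t : ℝ)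
    (x : Fin k → Fin d → ℝ) {I : Finset (Fin d)} (hI : I.card = k) :
    (Matrix.of fun r c => (aMat m ω t *ᵥ x c) (I.orderEmbOfFin hI r)).det =
      Real.exp (muI m ω I * t) * (Matrix.of fun r c => x c (I.orderEmbOfFin hI r)).det := by
  have h1 : Real.exp (muI m ω I * t) =
      ∏ r, Real.exp (signedWeight m ω (I.orderEmbOfFin hI r) * t) := by
    rw [← Real.exp_sum, ← Finset.sum_mul, muI]
    conv_lhs => rw [← I.map_orderEmbOfFin_univ hI, Finset.sum_map]
    rfl
  rw [h1, ← Matrix.det_mul_column]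
  congr 1
  ext r c
  simp [aMat, Matrix.mulVec_diagonal]

theorem exp_muI_mul_abs_det_le {m n k : ℕ} (hk : k ≤ m + n) {ω : Fin (m + n) → ℝ}
    (hω : IsWeightVector m n ω) {g : Matrix (Fin (m + n)) (Fin (m + n)) ℝ} (hg : g.det = 1)
    {t c δ : ℝ} {w : Fin k → Fin (m + n) → ℝ}
    (hfin : finrank ℝ (shortSpan (latticeOf g) (aMat m ω t) c) = k)
    {I : Finset (Fin (m + n))} (hI : I.card = k)
    (hδ : ∀ x : Fin k → Fin (m + n) → ℝ, (∀ j, x j ∈ latticeOf g) → LinearIndependent ℝ x →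
      (∀ j, x j ∈ shortSpan (latticeOf g) (aMat m ω t) c) → ∀ e : Fin k → Fin (m + n),
      δ * |(Matrix.of fun r c => w c (e r)).det| ≤ |(Matrix.of fun r c => x c (e r)).det|) :
    Real.exp (muI m ω I * t) * (δ * |(Matrix.of fun r c => w c (I.orderEmbOfFin hI r)).det|) ≤
      k.factorial * ((m + n : ℕ) : ℝ) ^ (m + n) := by
  have hdet : (aMat m ω t * g).det = 1 := by rw [Matrix.det_mul, hω.det_aMat, hg, one_mul]
  obtain ⟨v, hv, hli, hmin⟩ := exists_minimal_family (A := aMat m ω t * g) (by simp [hdet])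
  have hprod := prod_norm_le_of_minimal _ (by simp [hdet]) v hv hli hmin
  have hmono : Monotone fun i => ‖v i‖ := fun i j hij =>
    hmin i _ (hv j) (hli.notMem_span_image (by simpa using hij))
  have hC : (1 : ℝ) ≤ ((m + n : ℕ) : ℝ) ^ (m + n) := by
    exact_mod_cast Nat.pow_self_pos (n := m + n)
  have hprodk := prod_castLE_le hk (fun i => norm_nonneg (v i)) hmono hC hprod
  simp_rw [← mulVec_image_latticeOf] at hv
  choose x hx hxv using hv
  have hxli : LinearIndependent ℝ x := by
    refine LinearIndependent.of_comp (aMat m ω t).mulVecLin ?_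
    convert hli using 1
    exact funext hxv
  have hlow := hδ (x ∘ Fin.castLE hk) (fun j => hx _) (hxli.comp _ (Fin.castLE_injective hk))
    (fun j => mem_map_shortSpan_of_minimal (det_aMat_ne_zero m ω t) hmin
      (by rw [hfin]; exact j.2) (hx _) (hxv _)) (I.orderEmbOfFin hI)
  calc _ ≤ Real.exp (muI m ω I * t) *
        |(Matrix.of fun r c => (x ∘ Fin.castLE hk) c (I.orderEmbOfFin hI r)).det| := by gcongr
    _ = |(Matrix.of fun r c => v (Fin.castLE hk c) (I.orderEmbOfFin hI r)).det| := by
        rw [← Real.abs_exp (muI m ω I * t), ← abs_mul, ← det_aMat_mulVec_orderEmbOfFin]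
        simp [hxv]
    _ ≤ _ := abs_det_le_factorial_mul_prod_norm (fun c => v (Fin.castLE hk c)) _
    _ ≤ _ := by gcongr

theorem schmidt_summerer_geometric_connectedness
    (m n : ℕ) (hm : 0 < m) (hn : 0 < n) (hd : 2 ≤ m + n)
    (ω : Fin (m + n) → ℝ) (hω : IsWeightVector m n ω)
    (k : ℕ) (hk1 : 1 ≤ k) (hk2 : k ≤ m + n - 1)
    (g : Matrix (Fin (m + n)) (Fin (m + n)) ℝ) (hg : g.det = 1)
    (H : ∀ (W : Submodule ℝ (Fin (m + n) → ℝ)) (w : Fin k → (Fin (m + n) → ℝ)),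
      (∀ j, w j ∈ latticeOf g) → Submodule.span ℝ (Set.range w) = W →
      Module.finrank ℝ W = k →
      ∃ I : Finset (Fin (m + n)), I.card = k ∧ 0 < muI m ω I ∧
        W.map (coordProj (m + n) I) = coordSubspace (m + n) I) :
    ConnectedAt m ω (latticeOf g) k := by
  intro T
  by_contra! hcon
  have hk : k + 1 ≤ m + n := by omega
  have hg0 : g.det ≠ 0 := by simp [hg]
  have hlt : ∀ t, max T 0 ≤ t → succMin (m + n) (latticeOf (aMat m ω t * g)) k <
      succMin (m + n) (latticeOf (aMat m ω t * g)) (k + 1) := by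
    intro t ht
    have hdet : (aMat m ω t * g).det ≠ 0 := by simp [Matrix.det_mul, hg, hω.det_aMat]
    refine lt_of_le_of_ne (succMin_le_succ hk hdet) fun h => ?_
    refine hcon t ((le_max_right _ _).trans ht) ((le_max_left _ _).trans ht) ?_
    rw [Lfun, Lfun, mulVec_image_latticeOf, h]
  let W : ℝ → Submodule ℝ (Fin (m + n) → ℝ) := fun t => shortSpan (latticeOf g) (aMat m ω t)
    (succMin (m + n) (latticeOf (aMat m ω t * g)) (k + 1))
  have hloc : ∀ t ∈ Set.Ici (max T 0), ∀ᶠ s in nhdsWithin t (Set.Ici (max T 0)), W t = W s := by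
    intro t ht
    obtain ⟨w, -, -, hev⟩ := exists_eventually_shortSpan_eq m hk ω hg0 (hlt t ht)
    exact nhdsWithin_le_nhds (hev.mono fun s hs => hev.self_of_nhds.trans hs.symm)
  have hconst : ∀ t, max T 0 ≤ t → W t = W (max T 0) := fun t ht =>
    isPreconnected_Ici.induction₂ (fun s t => W s = W t) hloc
      (fun _ _ _ _ _ _ => Eq.trans) (fun _ _ _ _ => Eq.symm) ht Set.self_mem_Ici
  obtain ⟨w, hw, hwli, hev⟩ := exists_eventually_shortSpan_eq m hk ω hg0 (hlt _ le_rfl)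
  have hW : W (max T 0) = Submodule.span ℝ (Set.range w) := hev.self_of_nhds
  have hrank : finrank ℝ (Submodule.span ℝ (Set.range w)) = k := by
    rw [finrank_span_eq_card hwli, Fintype.card_fin]
  obtain ⟨I, hI, hμ, hmap⟩ := H _ w hw rfl hrank
  have hdet := det_ne_zero_of_map_coordProj_eq hI hmap
  obtain ⟨δ, hδ, hδle⟩ := exists_pos_mul_abs_det_le hg0 hw hwli
  have hpos := mul_pos hδ (abs_pos.2 hdet)
  have htend : Filter.Tendsto (fun t => Real.exp (muI m ω I * t) *
      (δ * |(Matrix.of fun r c => w c (I.orderEmbOfFin hI r)).det|)) Filter.atTop Filter.atTop :=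
    (Real.tendsto_exp_atTop.comp (Filter.tendsto_id.const_mul_atTop hμ)).atTop_mul_const hpos
  obtain ⟨t, ht, htT⟩ := ((htend.eventually_gt_atTop
    (k.factorial * ((m + n : ℕ) : ℝ) ^ (m + n))).and (Filter.eventually_ge_atTop (max T 0))).exists
  have hWt : shortSpan (latticeOf g) (aMat m ω t)
      (succMin (m + n) (latticeOf (aMat m ω t * g)) (k + 1)) = Submodule.span ℝ (Set.range w) :=
    (hconst t htT).trans hW
  refine ht.not_ge (exp_muI_mul_abs_det_le (by omega) hω hg (by rw [hWt, hrank]) hI ?_)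
  rw [hWt]
  exact hδle

end
end

section
/- Let d = m + n ≥ 2, let ω be an (m,n)-weight vector, let k ∈ {1,…,d−1}, and let W ⊂ ℝ^d be a k-dimensional linear subspace represented by v_W ∈ ⋀^k ℝ^d. Then there exists I ⊂ {1,…,d} of cardinality k with μ_I > 0 and π_I(W) = ℝ^I if and only if the largest eigenvalue appearing in the decomposition of v_W into eigenvectors of a_1^ω in ⋀^k ℝ^d is strictly greater than 1. -/
open scoped Classical
open MeasureTheory Module Matrix

noncomputable section

theorem range_coordProj (d : ℕ) (I : Finset (Fin d)) :
    LinearMap.range (coordProj d I) = coordSubspace d I := by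
  apply le_antisymm
  · rintro _ ⟨v, rfl⟩
    have hv : coordProj d I v = ∑ i ∈ I, v i • Pi.single i (1 : ℝ) := by
      funext j
      simp [coordProj, Finset.sum_apply, Pi.single_apply]
    rw [hv]
    exact Submodule.sum_mem _ fun i hi =>
      Submodule.smul_mem _ _ (Submodule.subset_span ⟨i, hi, rfl⟩)
  · refine Submodule.span_le.2 ?_
    rintro _ ⟨i, hi, rfl⟩
    refine ⟨Pi.single i 1, ?_⟩
    funext j
    by_cases h : j = i
    · subst h
      simp [coordProj, hi]
    · simp [coordProj, h]

theorem ker_coordProj {d k : ℕ} (I : Finset (Fin d)) (h : I.card = k) :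
    LinearMap.ker (coordProj d I) =
      LinearMap.ker (LinearMap.funLeft ℝ ℝ (I.orderEmbOfFin h)) := by
  ext v
  have hI : ∀ i, i ∈ I ↔ ∃ r, I.orderEmbOfFin h r = i := fun i => by
    rw [← Finset.mem_coe, ← Finset.range_orderEmbOfFin I h, Set.mem_range]
  simp [LinearMap.mem_ker, funext_iff, coordProj, LinearMap.funLeft_apply, hI]

theorem map_coordProj_eq_iff_gramCoeff_ne_zero {d k : ℕ} (w : Fin k → Fin d → ℝ)
    (I : Finset (Fin d)) (h : I.card = k) :
    (Submodule.span ℝ (Set.range w)).map (coordProj d I) = coordSubspace d I ↔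
      gramCoeff w I ≠ 0 := by
  have hsurj : LinearMap.range (LinearMap.funLeft ℝ ℝ (I.orderEmbOfFin h)) = ⊤ :=
    LinearMap.range_eq_top.2
      (LinearMap.funLeft_surjective_of_injective ℝ ℝ _ (I.orderEmbOfFin h).injective)
  have hspan_iff (v : Fin k → Fin k → ℝ) :
      Submodule.span ℝ (Set.range v) = ⊤ ↔ LinearIndependent ℝ v :=
    ⟨fun hv => linearIndependent_of_top_le_span_of_card_eq_finrank hv.ge (by simp),
      fun hv => hv.span_eq_top_of_card_eq_finrank' (by simp)⟩
  rw [← range_coordProj, Submodule.map_eq_range_iff, ker_coordProj I h,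
    ← Submodule.map_eq_range_iff, hsurj, Submodule.map_span, ← Set.range_comp, hspan_iff,
    gramCoeff, dif_pos h, ← isUnit_iff_ne_zero, ← Matrix.isUnit_iff_isUnit_det,
    ← Matrix.linearIndependent_cols_iff_isUnit]
  rfl

theorem geometric_iff_algebraic
    (m n : ℕ) (hm : 0 < m) (hn : 0 < n) (hd : 2 ≤ m + n)
    (ω : Fin (m + n) → ℝ) (hω : IsWeightVector m n ω)
    (k : ℕ) (hk1 : 1 ≤ k) (hk2 : k ≤ m + n - 1)
    (W : Submodule ℝ (Fin (m + n) → ℝ)) (w : Fin k → (Fin (m + n) → ℝ))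
    (hspan : Submodule.span ℝ (Set.range w) = W) (hrank : Module.finrank ℝ W = k) :
    (∃ I : Finset (Fin (m + n)), I.card = k ∧ 0 < muI m ω I ∧
        W.map (coordProj (m + n) I) = coordSubspace (m + n) I) ↔
      1 < largestEigAlong m ω w := by
  subst hspan
  have hfin : {r : ℝ | ∃ I : Finset (Fin (m + n)), I.card = k ∧ gramCoeff w I ≠ 0 ∧
      r = Real.exp (muI m ω I)}.Finite :=
    (Set.finite_range fun I : Finset (Fin (m + n)) => Real.exp (muI m ω I)).subset <| by
      rintro _ ⟨I, -, -, rfl⟩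
      exact ⟨I, rfl⟩
  constructor
  · rintro ⟨I, hI, hpos, hmap⟩
    exact (Real.one_lt_exp_iff.2 hpos).trans_le <| le_csSup hfin.bddAbove
      ⟨I, hI, (map_coordProj_eq_iff_gramCoeff_ne_zero w I hI).1 hmap, rfl⟩
  · intro hlt
    rw [largestEigAlong] at hlt
    obtain ⟨_, ⟨I, hI, hne, rfl⟩, hr⟩ := exists_lt_of_lt_csSup
      (Set.nonempty_iff_ne_empty.2 fun he => by
        rw [he, Real.sSup_empty] at hlt
        linarith) hlt
    exact ⟨I, hI, Real.one_lt_exp_iff.1 hr,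
      (map_coordProj_eq_iff_gramCoeff_ne_zero w I hI).2 hne⟩

end
end

section
/- Let d = m + n ≥ 2, let ω be an (m,n)-weight vector, let x ∈ M_{m,n}(ℝ), and let W ⊂ ℝ^d be a k-dimensional linear subspace represented by v_W ∈ ⋀^k ℝ^d. Then the largest eigenvalue appearing in the decomposition of u(x)v_W into eigenvectors of a_1^ω in ⋀^k ℝ^d equals exp(φ(x̃W) − ψ(ker x̃ ∩ W)). -/
open scoped Classical
open MeasureTheory Module Matrix

noncomputable section

/-- Weighted Abel summation: if all prefix sums of `h` are nonnegative, then pairing `h` with a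
decreasing `c` gives at least a lower bound of `c` times the total of `h`. -/
lemma mul_sum_le_sum_mul_of_antitone :
    ∀ (d : ℕ) (c h : Fin d → ℝ), Antitone c →
      (∀ s : ℕ, 0 ≤ ∑ t : Fin d, if (t : ℕ) < s then h t else 0) →
      ∀ L : ℝ, (∀ t, L ≤ c t) → L * ∑ t, h t ≤ ∑ t, c t * h t := by
  intro d
  induction d with
  | zero => intro c h _ _ L _; simp
  | succ d ih =>
    intro c h hc hs L hL
    have htot : 0 ≤ ∑ t : Fin (d + 1), h t := by
      have := hs (d + 1)
      rwa [Finset.sum_congr rfl (fun t _ => if_pos t.isLt)] at this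
    have hpre : ∀ s : ℕ, 0 ≤ ∑ t : Fin d, if (t : ℕ) < s then h t.castSucc else 0 := by
      intro s
      have h1 := hs (min s d)
      rw [Fin.sum_univ_castSucc, if_neg (by simp), add_zero] at h1
      convert h1 using 3 with t
      simp [t.isLt]
    have h2 := ih (fun t => c t.castSucc) (fun t => h t.castSucc)
      (fun a b hab => hc (Fin.castSucc_le_castSucc_iff.mpr hab)) hpre (c (Fin.last d))
      (fun t => hc (Fin.le_last _))
    have h3 : L * ∑ t, h t ≤ c (Fin.last d) * ∑ t, h t :=
      mul_le_mul_of_nonneg_right (hL _) htot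
    refine h3.trans ?_
    rw [Fin.sum_univ_castSucc, Fin.sum_univ_castSucc, mul_add]
    exact add_le_add_left h2 _

/-- A finset whose prefixes dominate those of another finset of the same size has the larger
sum of a decreasing function. -/
lemma sum_le_sum_of_card_prefix_le {d : ℕ} {c : Fin d → ℝ} (hc : Antitone c)
    {A B : Finset (Fin d)} (hcard : A.card = B.card)
    (h : ∀ s : ℕ, (A.filter fun t : Fin d => (t : ℕ) < s).card ≤
      (B.filter fun t : Fin d => (t : ℕ) < s).card) :
    ∑ t ∈ A, c t ≤ ∑ t ∈ B, c t := by
  have ind (C : Finset (Fin d)) (s : ℕ) :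
      (∑ t : Fin d, if (t : ℕ) < s then (if t ∈ C then (1 : ℝ) else 0) else 0) =
        (C.filter fun t : Fin d => (t : ℕ) < s).card := by
    rw [Finset.card_filter]
    push_cast
    rw [← Finset.sum_filter_add_sum_filter_not Finset.univ (· ∈ C)]
    rw [Finset.sum_eq_zero (s := Finset.univ.filter (· ∉ C))]
    · rw [add_zero, Finset.filter_univ_mem]
      exact Finset.sum_congr rfl fun t ht => by simp [ht]
    · intro t ht
      simp [(Finset.mem_filter.mp ht).2]
  obtain ⟨L, hL⟩ := (Set.finite_range c).bddBelow
  have key := mul_sum_le_sum_mul_of_antitone d c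
    (fun t => (if t ∈ B then (1 : ℝ) else 0) - (if t ∈ A then (1 : ℝ) else 0)) hc
    (fun s => by
      have : (∑ t : Fin d, if (t : ℕ) < s then
          ((if t ∈ B then (1 : ℝ) else 0) - (if t ∈ A then (1 : ℝ) else 0)) else 0) =
          (B.filter fun t : Fin d => (t : ℕ) < s).card -
            (A.filter fun t : Fin d => (t : ℕ) < s).card := by
        rw [← ind, ← ind, ← Finset.sum_sub_distrib]
        exact Finset.sum_congr rfl fun t _ => by split_ifs <;> simp
      rw [this, sub_nonneg]
      exact_mod_cast h s) L (fun t => hL ⟨t, rfl⟩)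
  simp only [Finset.sum_sub_distrib, mul_sub, mul_ite, mul_one, mul_zero, Finset.sum_ite_mem,
    Finset.univ_inter, Finset.sum_const, nsmul_eq_mul, hcard, sub_self] at key
  linarith

/-- The vectors of `U` whose first `s` coordinates, in the order given by `σ`, vanish. -/
def vanishingFlag {d : ℕ} (U : Submodule ℝ (Fin d → ℝ)) (σ : Equiv.Perm (Fin d)) (s : ℕ) :
    Submodule ℝ (Fin d → ℝ) where
  carrier := {u | u ∈ U ∧ ∀ t : Fin d, (t : ℕ) < s → u (σ t) = 0}
  add_mem' := fun ha hb => ⟨U.add_mem ha.1 hb.1, fun t ht => by simp [ha.2 t ht, hb.2 t ht]⟩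
  zero_mem' := ⟨U.zero_mem, fun _ _ => rfl⟩
  smul_mem' := fun c _ ha => ⟨U.smul_mem c ha.1, fun t ht => by simp [ha.2 t ht]⟩

/-- The positions, in the order given by `σ`, of the leading coordinates of vectors of `U`. -/
def leadingPositions {d : ℕ} (U : Submodule ℝ (Fin d → ℝ)) (σ : Equiv.Perm (Fin d)) :
    Finset (Fin d) :=
  Finset.univ.filter fun t => ∃ u ∈ vanishingFlag U σ t, u (σ t) ≠ 0

lemma finrank_vanishingFlag_succ {d : ℕ} (U : Submodule ℝ (Fin d → ℝ))
    (σ : Equiv.Perm (Fin d)) (t : Fin d) :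
    finrank ℝ (vanishingFlag U σ t) =
      finrank ℝ (vanishingFlag U σ (t + 1)) + if t ∈ leadingPositions U σ then 1 else 0 := by
  let f : vanishingFlag U σ t →ₗ[ℝ] ℝ :=
    (LinearMap.proj (σ t)).comp (vanishingFlag U σ t).subtype
  have hker : (LinearMap.ker f).map (vanishingFlag U σ t).subtype =
      vanishingFlag U σ (t + 1) := by
    ext u
    constructor
    · rintro ⟨v, hv, rfl⟩
      refine ⟨v.2.1, fun r hr => ?_⟩
      rcases Nat.lt_succ_iff_lt_or_eq.mp hr with h | h
      · exact v.2.2 r h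
      · rw [Fin.ext h]; exact hv
    · intro hu
      exact ⟨⟨u, hu.1, fun r hr => hu.2 r (by omega)⟩, hu.2 t (by omega), rfl⟩
  have hdim := LinearMap.finrank_range_add_finrank_ker f
  rw [← hker, ← (Submodule.equivSubtypeMap _ (LinearMap.ker f)).finrank_eq, ← hdim, add_comm]
  congr 1
  split_ifs with ht
  · obtain ⟨u, hu, hne⟩ := (Finset.mem_filter.mp ht).2
    have : LinearMap.range f = ⊤ := LinearMap.range_eq_top.mpr
      (LinearMap.surjective (f := f) fun h0 => hne (LinearMap.congr_fun h0 ⟨u, hu⟩))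
    rw [this, finrank_top, finrank_self]
  · have : f = 0 := by
      ext u
      by_contra hne
      exact ht (Finset.mem_filter.mpr ⟨Finset.mem_univ _, u.1, u.2, hne⟩)
    rw [this, LinearMap.range_zero, finrank_bot]

lemma card_filter_lt_succ {d : ℕ} (A : Finset (Fin d)) (t : Fin d) :
    (A.filter fun r : Fin d => (r : ℕ) < t + 1).card =
      (A.filter fun r : Fin d => (r : ℕ) < t).card + if t ∈ A then 1 else 0 := by
  have : (A.filter fun r : Fin d => (r : ℕ) < t + 1) =
      (A.filter fun r : Fin d => (r : ℕ) < t) ∪ if t ∈ A then {t} else ∅ := by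
    ext r
    by_cases hrt : r = t
    · subst hrt; by_cases hr : r ∈ A <;> simp [hr]
    · have : (r : ℕ) ≠ t := fun h => hrt (Fin.ext h)
      split_ifs <;> simp [hrt] <;> omega
  rw [this, Finset.card_union_of_disjoint]
  · split_ifs <;> simp
  · split_ifs <;> simp

lemma finrank_vanishingFlag_add_card {d : ℕ} (U : Submodule ℝ (Fin d → ℝ))
    (σ : Equiv.Perm (Fin d)) (s : ℕ) (hs : s ≤ d) :
    finrank ℝ (vanishingFlag U σ s) +
      ((leadingPositions U σ).filter fun t : Fin d => (t : ℕ) < s).card = finrank ℝ U := by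
  induction s with
  | zero =>
    have : vanishingFlag U σ 0 = U := by
      ext u
      exact ⟨fun h => h.1, fun h => ⟨h, fun t ht => absurd ht (Nat.not_lt_zero _)⟩⟩
    simp only [not_lt_zero, Finset.filter_false, Finset.card_empty, add_zero]
    rw [this]
  | succ s ih =>
    have h1 := finrank_vanishingFlag_succ U σ ⟨s, hs⟩
    have h2 := card_filter_lt_succ (leadingPositions U σ) ⟨s, hs⟩
    have h3 := ih (by omega)
    simp only at h1 h2
    omega

lemma vanishingFlag_eq_bot {d : ℕ} (U : Submodule ℝ (Fin d → ℝ))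
    (σ : Equiv.Perm (Fin d)) : vanishingFlag U σ d = ⊥ := by
  rw [eq_bot_iff]
  intro u hu
  rw [Submodule.mem_bot]
  ext i
  simpa using hu.2 (σ.symm i) (Fin.isLt _)

lemma card_leadingPositions {d : ℕ} (U : Submodule ℝ (Fin d → ℝ))
    (σ : Equiv.Perm (Fin d)) : (leadingPositions U σ).card = finrank ℝ U := by
  have h := finrank_vanishingFlag_add_card U σ d le_rfl
  rw [vanishingFlag_eq_bot, finrank_bot, zero_add] at h
  rw [← h, Finset.filter_true_of_mem fun t _ => t.isLt]

/-- The finset `T` of positions of a coordinate set on which `U` injects has prefixes dominated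
by those of the leading positions. -/
lemma card_prefix_le_card_prefix_leadingPositions {d : ℕ} (U : Submodule ℝ (Fin d → ℝ))
    (σ : Equiv.Perm (Fin d)) (T : Finset (Fin d)) (hT : T.card = finrank ℝ U)
    (hinj : ∀ u ∈ U, (∀ t ∈ T, u (σ t) = 0) → u = 0) (s : ℕ) :
    (T.filter fun t : Fin d => (t : ℕ) < s).card ≤
      ((leadingPositions U σ).filter fun t : Fin d => (t : ℕ) < s).card := by
  rcases le_total s d with hs | hs
  · have h1 := finrank_vanishingFlag_add_card U σ s hs
    have h2 := Finset.card_filter_add_card_filter_not (s := T) (fun t : Fin d => (t : ℕ) < s)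
    let f : vanishingFlag U σ s →ₗ[ℝ]
        ({t // t ∈ T.filter fun t : Fin d => ¬ (t : ℕ) < s} → ℝ) :=
      LinearMap.pi fun t => (LinearMap.proj (σ t.1)).comp (vanishingFlag U σ s).subtype
    have hf : Function.Injective f := by
      rw [injective_iff_map_eq_zero]
      intro u hu
      refine Subtype.ext (hinj u.1 u.2.1 fun t ht => ?_)
      by_cases hts : (t : ℕ) < s
      · exact u.2.2 t hts
      · exact congrFun hu ⟨t, Finset.mem_filter.mpr ⟨ht, hts⟩⟩
    have h3 := LinearMap.finrank_le_finrank_of_injective hf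
    rw [finrank_fintype_fun_eq_card, Fintype.card_coe] at h3
    omega
  · rw [Finset.filter_true_of_mem fun t _ => t.isLt.trans_le hs,
      Finset.filter_true_of_mem fun t _ => t.isLt.trans_le hs, hT, card_leadingPositions]

lemma eq_zero_of_forall_leadingPositions {d : ℕ} (U : Submodule ℝ (Fin d → ℝ))
    (σ : Equiv.Perm (Fin d)) (u : Fin d → ℝ) (hu : u ∈ U)
    (h : ∀ t ∈ leadingPositions U σ, u (σ t) = 0) : u = 0 := by
  have key : ∀ s : ℕ, ∀ t : Fin d, (t : ℕ) = s → u (σ t) = 0 := by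
    intro s
    induction s using Nat.strong_induction_on with
    | _ s ih =>
      rintro t rfl
      by_contra hne
      exact hne (h t (Finset.mem_filter.mpr ⟨Finset.mem_univ _, u,
        ⟨hu, fun r hr => ih r hr r rfl⟩, hne⟩))
  ext i
  simpa using key _ (σ.symm i) rfl

/-- The minor on rows `I` of linearly independent vectors is nonzero iff their span injects into
the coordinates in `I`. -/
lemma gramCoeff_ne_zero_iff {d k : ℕ} {w : Fin k → Fin d → ℝ} (hw : LinearIndependent ℝ w)
    {I : Finset (Fin d)} (hI : I.card = k) :
    gramCoeff w I ≠ 0 ↔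
      ∀ u ∈ Submodule.span ℝ (Set.range w), (∀ i ∈ I, u i = 0) → u = 0 := by
  have hmul (v : Fin k → ℝ) (r : Fin k) :
      ((Matrix.of fun r c : Fin k => w c (I.orderEmbOfFin hI r)) *ᵥ v) r =
        (∑ c, v c • w c) (I.orderEmbOfFin hI r) := by
    simp [Matrix.mulVec, dotProduct, mul_comm]
  rw [gramCoeff, dif_pos hI]
  constructor
  · intro hdet u hu hz
    obtain ⟨v, rfl⟩ := (Submodule.mem_span_range_iff_exists_fun ℝ).mp hu
    have : v = 0 := Matrix.eq_zero_of_mulVec_eq_zero hdet (by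
      ext r
      rw [hmul]
      exact hz _ (Finset.orderEmbOfFin_mem I hI r))
    simp [this]
  · intro hinj hdet
    obtain ⟨v, hv, hMv⟩ := Matrix.exists_mulVec_eq_zero_iff.mpr hdet
    refine hv (funext (Fintype.linearIndependent_iff.mp hw v (hinj _ ?_ fun i hi => ?_)))
    · exact (Submodule.mem_span_range_iff_exists_fun ℝ).mpr ⟨v, rfl⟩
    · obtain ⟨r, rfl⟩ : ∃ r, I.orderEmbOfFin hI r = i := by
        have : i ∈ Set.range (I.orderEmbOfFin hI) := by
          rw [Finset.range_orderEmbOfFin]; exact hi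
        exact this
      rw [← hmul, hMv]
      rfl

/-- The largest eigenvalue along a decomposable vector is attained at the leading coordinates
with respect to any ordering of the coordinates by decreasing weight. -/
lemma largestEigAlong_eq_exp_sum_leadingPositions (m : ℕ) {d k : ℕ} (ω : Fin d → ℝ)
    (w : Fin k → Fin d → ℝ) (hw : LinearIndependent ℝ w) (σ : Equiv.Perm (Fin d))
    (hσ : Antitone fun t => signedWeight m ω (σ t)) :
    largestEigAlong m ω w = Real.exp
      (∑ t ∈ leadingPositions (Submodule.span ℝ (Set.range w)) σ, signedWeight m ω (σ t)) := by
  have hrank : finrank ℝ (Submodule.span ℝ (Set.range w)) = k := by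
    simpa using finrank_span_eq_card hw
  refine IsGreatest.csSup_eq ⟨?_, ?_⟩
  · refine ⟨(leadingPositions (Submodule.span ℝ (Set.range w)) σ).map σ.toEmbedding, ?_, ?_, ?_⟩
    · rw [Finset.card_map, card_leadingPositions, hrank]
    · rw [gramCoeff_ne_zero_iff hw (by rw [Finset.card_map, card_leadingPositions, hrank])]
      intro u hu h
      exact eq_zero_of_forall_leadingPositions _ σ u hu fun t ht =>
        h _ (Finset.mem_map_of_mem σ.toEmbedding ht)
    · rw [muI, Finset.sum_map]
      rfl
  · rintro _ ⟨I, hI, hne, rfl⟩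
    rw [gramCoeff_ne_zero_iff hw hI] at hne
    rw [Real.exp_le_exp]
    have hmap : muI m ω I = ∑ t ∈ I.map σ.symm.toEmbedding, signedWeight m ω (σ t) := by
      simp [muI, Finset.sum_map]
    rw [hmap]
    have hcard : (I.map σ.symm.toEmbedding).card =
        finrank ℝ (Submodule.span ℝ (Set.range w)) := by
      rw [Finset.card_map, hI, hrank]
    refine sum_le_sum_of_card_prefix_le hσ (by rw [hcard, card_leadingPositions]) ?_
    refine card_prefix_le_card_prefix_leadingPositions _ σ _ hcard fun u hu h => ?_
    refine hne u hu fun i hi => ?_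
    simpa using h (σ.symm i) (Finset.mem_map_of_mem σ.symm.toEmbedding hi)

lemma finrank_lt_finrank_iff_of_le {V : Type*} [AddCommGroup V] [Module ℝ V]
    [FiniteDimensional ℝ V] {A B : Submodule ℝ V} (h : A ≤ B) :
    finrank ℝ A < finrank ℝ B ↔ ∃ v ∈ B, v ∉ A := by
  constructor
  · intro hlt
    by_contra! hBA
    exact hlt.ne (by rw [le_antisymm h hBA])
  · rintro ⟨v, hB, hA⟩
    exact Submodule.finrank_lt_finrank_of_lt (lt_of_le_of_ne h fun e => hA (e ▸ hB))

lemma mem_span_single_iff {d : ℕ} (p : Fin d → Prop) (v : Fin d → ℝ) :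
    v ∈ Submodule.span ℝ {u | ∃ i, p i ∧ u = Pi.single i (1 : ℝ)} ↔ ∀ i, ¬ p i → v i = 0 := by
  constructor
  · intro hv i hi
    have hle : Submodule.span ℝ {u | ∃ i, p i ∧ u = Pi.single i (1 : ℝ)} ≤
        LinearMap.ker (LinearMap.proj i : (Fin d → ℝ) →ₗ[ℝ] ℝ) := by
      rw [Submodule.span_le]
      rintro _ ⟨j, hj, rfl⟩
      have hij : i ≠ j := fun e => hi (e ▸ hj)
      simp [hij]
    exact hle hv
  · intro h
    rw [pi_eq_sum_univ' v]
    refine Submodule.sum_mem _ fun i _ => ?_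
    by_cases hi : p i
    · refine Submodule.smul_mem _ _ (Submodule.subset_span ⟨i, hi, ?_⟩)
      ext j
      simp [Pi.single_apply]
    · rw [h i hi, zero_smul]
      exact Submodule.zero_mem _

lemma mem_Espan {d j : ℕ} (v : Fin d → ℝ) :
    v ∈ Espan d j ↔ ∀ i : Fin d, j ≤ (i : ℕ) → v i = 0 := by
  simpa [Espan] using mem_span_single_iff (fun i : Fin d => (i : ℕ) < j) v

lemma mem_Eprime {m j : ℕ} (v : Fin m → ℝ) :
    v ∈ Eprime m j ↔ ∀ i : Fin m, (i : ℕ) < j → v i = 0 := by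
  simpa [Eprime] using mem_span_single_iff (fun i : Fin m => j ≤ (i : ℕ)) v

lemma mem_Iset {m d : ℕ} (W : Submodule ℝ (Fin d → ℝ)) (i : Fin d) :
    i ∈ Iset m W ↔
      m ≤ (i : ℕ) ∧ ∃ v ∈ W, v i ≠ 0 ∧ ∀ r : Fin d, (i : ℕ) < r → v r = 0 := by
  rw [Iset, Finset.mem_filter, finrank_lt_finrank_iff_of_le]
  · simp only [Finset.mem_univ, true_and, Submodule.mem_inf, mem_Espan]
    refine and_congr_right fun _ => ⟨?_, ?_⟩
    · rintro ⟨v, ⟨hv, hz⟩, hn⟩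
      refine ⟨v, hv, fun h0 => hn ⟨hv, fun r hr => ?_⟩, fun r hr => hz r hr⟩
      rcases hr.eq_or_lt with h | h
      · rw [← Fin.ext h]; exact h0
      · exact hz r h
    · rintro ⟨v, hv, hne, hz⟩
      exact ⟨v, ⟨hv, fun r hr => hz r hr⟩, fun h => hne (h.2 i le_rfl)⟩
  · refine inf_le_inf_left _ fun v => ?_
    simp only [mem_Espan]
    exact fun h r hr => h r (by omega)

lemma mem_Jset {m : ℕ} (W : Submodule ℝ (Fin m → ℝ)) (j : Fin m) :
    j ∈ Jset W ↔ ∃ v ∈ W, v j ≠ 0 ∧ ∀ r : Fin m, r < j → v r = 0 := by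
  rw [Jset, Finset.mem_filter, finrank_lt_finrank_iff_of_le]
  · simp only [Finset.mem_univ, true_and, Submodule.mem_inf, mem_Eprime]
    constructor
    · rintro ⟨v, ⟨hv, hz⟩, hn⟩
      refine ⟨v, hv, fun h0 => hn ⟨hv, fun r hr => ?_⟩, fun r hr => hz r hr⟩
      rcases Nat.lt_succ_iff_lt_or_eq.mp hr with h | h
      · exact hz r h
      · rw [Fin.ext h]; exact h0
    · rintro ⟨v, hv, hne, hz⟩
      exact ⟨v, ⟨hv, fun r hr => hz r hr⟩, fun h => hne (h.2 j (Nat.lt_succ_self _))⟩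
  · refine inf_le_inf_left _ fun v => ?_
    simp only [mem_Eprime]
    exact fun h r hr => h r (by omega)

/-- The order `1, …, m, d, d - 1, …, m + 1` of the coordinates, in which the signed weights
decrease. -/
def weightOrder (m n : ℕ) : Equiv.Perm (Fin (m + n)) :=
  finSumFinEquiv.symm.trans
    ((Equiv.sumCongr (Equiv.refl (Fin m)) Fin.revPerm).trans finSumFinEquiv)

@[simp]
lemma weightOrder_castAdd (m n : ℕ) (j : Fin m) :
    weightOrder m n (Fin.castAdd n j) = Fin.castAdd n j := by
  simp [weightOrder]

@[simp]
lemma weightOrder_natAdd (m n : ℕ) (j : Fin n) :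
    weightOrder m n (Fin.natAdd m j) = Fin.natAdd m j.rev := by
  simp [weightOrder]

lemma signedWeight_castAdd {m n : ℕ} (ω : Fin (m + n) → ℝ) (j : Fin m) :
    signedWeight m ω (Fin.castAdd n j) = ω (Fin.castAdd n j) := by
  simp [signedWeight]

lemma signedWeight_natAdd {m n : ℕ} (ω : Fin (m + n) → ℝ) (j : Fin n) :
    signedWeight m ω (Fin.natAdd m j) = -ω (Fin.natAdd m j) := by
  simp [signedWeight]

lemma antitone_signedWeight_weightOrder {m n : ℕ} {ω : Fin (m + n) → ℝ}
    (hω : IsWeightVector m n ω) : Antitone fun t => signedWeight m ω (weightOrder m n t) := by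
  obtain ⟨hpos, hfst, hsnd, -, -⟩ := hω
  intro a b
  induction a using Fin.addCases with
  | left a =>
    induction b using Fin.addCases with
    | left b =>
      intro hab
      simp only [weightOrder_castAdd, signedWeight_castAdd]
      exact hfst _ _ hab (by simp)
    | right b =>
      intro _
      simp only [weightOrder_castAdd, weightOrder_natAdd, signedWeight_castAdd,
        signedWeight_natAdd]
      linarith [hpos (Fin.castAdd n a), hpos (Fin.natAdd m b.rev)]
  | right a =>
    induction b using Fin.addCases with
    | left b =>
      intro hab
      rw [Fin.le_def] at hab
      simp only [Fin.val_natAdd, Fin.val_castAdd] at hab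
      omega
    | right b =>
      intro hab
      rw [Fin.le_def] at hab
      simp only [Fin.val_natAdd] at hab
      simp only [weightOrder_natAdd, signedWeight_natAdd, neg_le_neg_iff]
      refine hsnd _ _ (by simp) ?_
      rw [Fin.le_def]
      simp only [Fin.val_natAdd, Fin.val_rev]
      omega

lemma uMat_mulVec_castAdd {m n : ℕ} (x : Matrix (Fin m) (Fin n) ℝ) (v : Fin (m + n) → ℝ)
    (j : Fin m) : (uMat m n x *ᵥ v) (Fin.castAdd n j) = (xTil m n x *ᵥ v) j :=
  rfl

lemma uMat_mulVec_natAdd {m n : ℕ} (x : Matrix (Fin m) (Fin n) ℝ) (v : Fin (m + n) → ℝ)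
    (j : Fin n) : (uMat m n x *ᵥ v) (Fin.natAdd m j) = v (Fin.natAdd m j) := by
  simp [uMat, Matrix.mulVec, dotProduct, Fin.sum_univ_add, Matrix.one_apply]

lemma xTil_mulVec {m n : ℕ} (x : Matrix (Fin m) (Fin n) ℝ) (v : Fin (m + n) → ℝ)
    (j : Fin m) : (xTil m n x *ᵥ v) j =
      v (Fin.castAdd n j) + ∑ l, x j l * v (Fin.natAdd m l) := by
  simp [xTil, uMat, Matrix.mulVec, dotProduct, Fin.sum_univ_add, Matrix.one_apply]

lemma uMat_mulVecLin_injective {m n : ℕ} (x : Matrix (Fin m) (Fin n) ℝ) :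
    Function.Injective (uMat m n x).mulVecLin := by
  rw [injective_iff_map_eq_zero]
  intro v hv
  have hv (i) : (uMat m n x *ᵥ v) i = 0 := congrFun hv i
  have hr (l : Fin n) : v (Fin.natAdd m l) = 0 := by rw [← uMat_mulVec_natAdd x v, hv]
  ext i
  induction i using Fin.addCases with
  | left j =>
    have := hv (Fin.castAdd n j)
    rw [uMat_mulVec_castAdd, xTil_mulVec] at this
    simpa [hr] using this
  | right l => exact hr l

lemma castAdd_mem_leadingPositions_iff {m n : ℕ} (x : Matrix (Fin m) (Fin n) ℝ)
    (W : Submodule ℝ (Fin (m + n) → ℝ)) (j : Fin m) :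
    Fin.castAdd n j ∈ leadingPositions (W.map (uMat m n x).mulVecLin) (weightOrder m n) ↔
      j ∈ Jset (W.map (xTil m n x).mulVecLin) := by
  rw [mem_Jset, leadingPositions, Finset.mem_filter]
  constructor
  · rintro ⟨-, _, ⟨⟨v, hv, rfl⟩, hz⟩, hne⟩
    refine ⟨_, ⟨v, hv, rfl⟩, ?_, fun r hr => ?_⟩
    · simpa [uMat_mulVec_castAdd] using hne
    · simpa [uMat_mulVec_castAdd] using hz (Fin.castAdd n r) hr
  · rintro ⟨_, ⟨v, hv, rfl⟩, hne, hz⟩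
    refine ⟨Finset.mem_univ _, _, ⟨⟨v, hv, rfl⟩, fun t ht => ?_⟩, ?_⟩
    · induction t using Fin.addCases with
      | left r => simpa [uMat_mulVec_castAdd] using hz r ht
      | right r =>
        simp only [Fin.val_natAdd, Fin.val_castAdd] at ht
        omega
    · simpa [uMat_mulVec_castAdd] using hne

lemma natAdd_rev_mem_leadingPositions_iff {m n : ℕ} (x : Matrix (Fin m) (Fin n) ℝ)
    (W : Submodule ℝ (Fin (m + n) → ℝ)) (j : Fin n) :
    Fin.natAdd m j.rev ∈ leadingPositions (W.map (uMat m n x).mulVecLin) (weightOrder m n) ↔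
      Fin.natAdd m j ∈ Iset m (kerXtil m n x ⊓ W) := by
  rw [mem_Iset, leadingPositions, Finset.mem_filter]
  constructor
  · rintro ⟨-, _, ⟨⟨v, hv, rfl⟩, hz⟩, hne⟩
    refine ⟨by simp, v, ⟨?_, hv⟩, ?_, fun r => ?_⟩
    · refine LinearMap.mem_ker.mpr (funext fun r => ?_)
      have := hz (Fin.castAdd n r) (by simp only [Fin.val_natAdd, Fin.val_castAdd]; omega)
      simpa [uMat_mulVec_castAdd] using this
    · simpa [uMat_mulVec_natAdd] using hne
    · induction r using Fin.addCases with
      | left r =>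
        intro hr
        simp only [Fin.val_natAdd, Fin.val_castAdd] at hr
        omega
      | right r =>
        intro hr
        simp only [Fin.val_natAdd] at hr
        have := hz (Fin.natAdd m r.rev) (by simp only [Fin.val_natAdd, Fin.val_rev]; omega)
        simpa [uMat_mulVec_natAdd] using this
  · rintro ⟨-, v, ⟨hker, hv⟩, hne, hz⟩
    refine ⟨Finset.mem_univ _, _, ⟨⟨v, hv, rfl⟩, fun t => ?_⟩, ?_⟩
    · induction t using Fin.addCases with
      | left r =>
        intro _
        have : (xTil m n x *ᵥ v) r = 0 := congrFun (LinearMap.mem_ker.mp hker) r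
        simpa [uMat_mulVec_castAdd] using this
      | right r =>
        intro hr
        simp only [Fin.val_natAdd, Fin.val_rev] at hr
        have := hz (Fin.natAdd m r.rev) (by simp only [Fin.val_natAdd, Fin.val_rev]; omega)
        simpa [uMat_mulVec_natAdd] using this
    · simpa [uMat_mulVec_natAdd] using hne

lemma sum_leadingPositions_weightOrder {m n : ℕ} (ω : Fin (m + n) → ℝ)
    (x : Matrix (Fin m) (Fin n) ℝ) (W : Submodule ℝ (Fin (m + n) → ℝ)) :
    ∑ t ∈ leadingPositions (W.map (uMat m n x).mulVecLin) (weightOrder m n),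
        signedWeight m ω (weightOrder m n t) =
      phiF m n ω (W.map (xTil m n x).mulVecLin) - psiF m ω (kerXtil m n x ⊓ W) := by
  have hpsi : psiF m ω (kerXtil m n x ⊓ W) =
      ∑ j : Fin n, if Fin.natAdd m j ∈ Iset m (kerXtil m n x ⊓ W) then
        ω (Fin.natAdd m j) else 0 := by
    have hnot (j : Fin m) : Fin.castAdd n j ∉ Iset m (kerXtil m n x ⊓ W) := by
      simp [mem_Iset]
    rw [psiF, ← Finset.univ_inter (Iset m _), ← Finset.sum_ite_mem, Fin.sum_univ_add]
    simp [hnot]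
  rw [hpsi, phiF, ← Finset.univ_inter (leadingPositions _ _), ← Finset.sum_ite_mem,
    Fin.sum_univ_add, ← Finset.univ_inter (Jset _), ← Finset.sum_ite_mem, sub_eq_add_neg,
    ← Finset.sum_neg_distrib]
  congr 1
  · refine Finset.sum_congr rfl fun j _ => ?_
    simp only [castAdd_mem_leadingPositions_iff, weightOrder_castAdd, signedWeight_castAdd]
  · rw [← Equiv.sum_comp Fin.revPerm]
    refine Finset.sum_congr rfl fun j _ => ?_
    simp only [Fin.revPerm_apply, natAdd_rev_mem_leadingPositions_iff, weightOrder_natAdd,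
      Fin.rev_rev, signedWeight_natAdd]
    split_ifs <;> simp

theorem largest_eigenvalue_eq_exp_phi_sub_psi
    (m n : ℕ) (hm : 0 < m) (hn : 0 < n) (hd : 2 ≤ m + n)
    (ω : Fin (m + n) → ℝ) (hω : IsWeightVector m n ω)
    (x : Matrix (Fin m) (Fin n) ℝ)
    (k : ℕ) (hk1 : 1 ≤ k) (hk2 : k ≤ m + n - 1)
    (W : Submodule ℝ (Fin (m + n) → ℝ)) (w : Fin k → (Fin (m + n) → ℝ))
    (hspan : Submodule.span ℝ (Set.range w) = W) (hrank : Module.finrank ℝ W = k) :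
    largestEigAlong m ω (fun j => (uMat m n x).mulVec (w j)) =
      Real.exp (phiF m n ω (W.map (xTil m n x).mulVecLin) -
        psiF m ω (kerXtil m n x ⊓ W)) := by
  subst hspan
  have hw : LinearIndependent ℝ w :=
    linearIndependent_iff_card_eq_finrank_span.mpr (by rw [Fintype.card_fin]; exact hrank.symm)
  have hw' : LinearIndependent ℝ fun j => (uMat m n x) *ᵥ (w j) :=
    hw.map' (uMat m n x).mulVecLin (LinearMap.ker_eq_bot.mpr (uMat_mulVecLin_injective x))
  have hU : Submodule.span ℝ (Set.range fun j => (uMat m n x) *ᵥ (w j)) =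
      (Submodule.span ℝ (Set.range w)).map (uMat m n x).mulVecLin := by
    rw [Submodule.map_span, ← Set.range_comp]
    rfl
  rw [largestEigAlong_eq_exp_sum_leadingPositions m ω _ hw' (weightOrder m n)
    (antitone_signedWeight_weightOrder hω), hU, sum_leadingPositions_weightOrder]

end
end
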